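/- arXiv:1901.02632 — 3 statements merged into one kernel-verified Lean document; each statement's English description precedes it below -/
import Mathlib

section
/- Let K be a field, let S_1, …, S_n be pairwise disjoint sets of valuation rings of K, and let x_1, …, x_n ∈ K, z_1, …, z_n ∈ K^×. Assume: (U) there exists a common uniformizer π ∈ K^× of all v ∈ S_1 ∪ ⋯ ∪ S_n; (T) each S_i is compact in the Zariski topology on the set of valuation rings of K; (I) for any valuation ring O_w of K containing a member of S_i and a member of S_j we have x_i − x_j ∈ z_i·O_w and z_i·O_w = z_j·O_w. Then there exists x ∈ K with (x − x_i)/z_i ∈ m_v for all v ∈ S_i, for i = 1, …, n. -/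
namespace PaperApprox

variable {K : Type*} [Field K]

/-- The "maximal ideal" `m_O = O \ O^×` of a ball `O`, where `O^× = O ∩ O⁻¹` and
`O⁻¹ = {x⁻¹ : 0 ≠ x ∈ O} = {x | x ≠ 0 ∧ x⁻¹ ∈ O}`. -/
def mball (O : Set K) : Set K := O \ (O ∩ {x | x ≠ 0 ∧ x⁻¹ ∈ O})

/-- The scaled set `z·S`. -/
def scale (z : K) (S : Set K) : Set K := {y | ∃ s ∈ S, y = z * s}

/-- A positive cone of a field ordering. -/
def IsOrderingCone (P : Set K) : Prop :=
  (∀ a ∈ P, ∀ b ∈ P, a + b ∈ P) ∧ (∀ a ∈ P, ∀ b ∈ P, a * b ∈ P) ∧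
    (∀ x : K, x ∈ P ∨ -x ∈ P) ∧ ∀ x : K, x ∈ P → -x ∈ P → x = 0

/-- `x ≤_P y` for a positive cone `P`. -/
def coneLE (P : Set K) (a b : K) : Prop := b - a ∈ P

/-- `x <_P y` for a positive cone `P`. -/
def coneLT (P : Set K) (a b : K) : Prop := b - a ∈ P ∧ a ≠ b

/-- The unit interval `{x : -1 ≤_P x ≤_P 1}` of an ordering. -/
def orderingBall (P : Set K) : Set K := {x | x + 1 ∈ P ∧ 1 - x ∈ P}

/-- `O` is the valuation ring of a (Krull) valuation on `K`. -/
def IsValuationLocality (O : Set K) : Prop := ∃ A : ValuationSubring K, O = (A : Set K)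

/-- `O` is the unit interval of a field ordering of `K`. -/
def IsOrderingLocality (O : Set K) : Prop := ∃ P : Set K, IsOrderingCone P ∧ O = orderingBall P

/-- `O` is the closed unit ball of an absolute value on `K`. -/
def IsAbsLocality (O : Set K) : Prop := ∃ f : AbsoluteValue K ℝ, O = {x | f x ≤ 1}

/-- A locality on `K`, identified with its ring/ball `O`. -/
def IsLocality (O : Set K) : Prop := IsValuationLocality O ∨ IsOrderingLocality O ∨ IsAbsLocality O

/-- `W` is the finest common coarsening of the localities `O₁`, `O₂`. -/
def IsFCC (O₁ O₂ W : Set K) : Prop :=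
  IsLocality W ∧ O₁ ⊆ W ∧ O₂ ⊆ W ∧ ∀ W', IsLocality W' → O₁ ⊆ W' → O₂ ⊆ W' → W ⊆ W'

/-- Two subsets `A`, `B` of `W` have the same image in the residue field `W/m_W`. -/
def SameResidue (W A B : Set K) : Prop :=
  (∀ x ∈ A, ∃ y ∈ B, x - y ∈ mball W) ∧ ∀ y ∈ B, ∃ x ∈ A, x - y ∈ mball W

/-- Incomparability of localities. -/
def Incomp (O₁ O₂ : Set K) : Prop := ¬O₁ ⊆ O₂ ∧ ¬O₂ ⊆ O₁

/-- Strong incomparability: incomparable, and the induced localities on the residue field of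
the finest common coarsening are distinct (their rings, i.e. the images of `O₁` and `O₂`,
differ). -/
def StronglyIncomp (O₁ O₂ : Set K) : Prop :=
  Incomp O₁ O₂ ∧ ∀ W, IsFCC O₁ O₂ W → ¬SameResidue W O₁ O₂

/-- `t`-independence of localities. -/
def TIndep (t : K) (O₁ O₂ : Set K) : Prop :=
  (∀ W, IsFCC O₁ O₂ W → t ∈ W ∧ t⁻¹ ∈ W) ∧
    (IsOrderingLocality O₁ → IsOrderingLocality O₂ → StronglyIncomp O₁ O₂)

/-- `t`-independence of valuation rings: `t` and `t⁻¹` lie in the smallest valuation ring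
containing both. -/
def TIndepVal (t : K) (O₁ O₂ : Set K) : Prop :=
  ∀ W : Set K, IsValuationLocality W → O₁ ⊆ W → O₂ ⊆ W →
    (∀ W', IsValuationLocality W' → O₁ ⊆ W' → O₂ ⊆ W' → W ⊆ W') → t ∈ W ∧ t⁻¹ ∈ W

/-- `t`-independence of sets of localities. -/
def SetTIndep (t : K) (S₁ S₂ : Set (Set K)) : Prop := ∀ v ∈ S₁, ∀ w ∈ S₂, TIndep t v w

/-- Incomparability of sets of localities. -/
def SetIncomp (S₁ S₂ : Set (Set K)) : Prop := ∀ v ∈ S₁, ∀ w ∈ S₂, Incomp v w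

/-- Independence of localities: the field topologies they induce on `K` (with the sets
`z·m_v`, `z ∈ K^×`, as neighbourhood bases of `0`) are distinct. -/
def IndepLoc (O₁ O₂ : Set K) : Prop :=
  ¬((∀ z : K, z ≠ 0 → ∃ z' : K, z' ≠ 0 ∧ scale z' (mball O₂) ⊆ scale z (mball O₁)) ∧
     ∀ z : K, z ≠ 0 → ∃ z' : K, z' ≠ 0 ∧ scale z' (mball O₁) ⊆ scale z (mball O₂))

/-- The Zariski topology on localities/balls of `K`. -/
def zarTop (K : Type*) [Field K] : TopologicalSpace (Set K) :=
  TopologicalSpace.generateFrom {U | ∃ x : K, U = {O : Set K | x ∈ O}}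

/-- The Hochster dual of the Zariski topology. -/
def zarStarTop (K : Type*) [Field K] : TopologicalSpace (Set K) :=
  TopologicalSpace.generateFrom {U | ∃ x : K, U = {O : Set K | x ∈ mball O}}

/-- The constructible topology. -/
def conTop (K : Type*) [Field K] : TopologicalSpace (Set K) :=
  TopologicalSpace.generateFrom
    ({U | ∃ x : K, U = {O : Set K | x ∈ O}} ∪ {U | ∃ x : K, U = {O : Set K | x ∈ mball O}})

/-- The Harrison topology on orderings (positive cones) of `K`. -/
def harrisonTop (K : Type*) [Field K] : TopologicalSpace (Set K) :=
  TopologicalSpace.generateFrom {U | ∃ x : K, x ≠ 0 ∧ U = {P : Set K | x ∈ P}}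

/-- Condition (i): `f(O) ⊆ O`. -/
def CondI (f : Polynomial K) (O : Set K) : Prop := ∀ x ∈ O, f.eval x ∈ O

/-- Condition (ii): `f(x) ∉ t·m_O` for `x ∈ O`. -/
def CondII (t : K) (f : Polynomial K) (O : Set K) : Prop := ∀ x ∈ O, f.eval x ∉ scale t (mball O)

/-- Condition (iii): `f(x) ∈ x^d (O \ t·m_O) ∩ (a_d x^d + x^(d-1) O)` for `x ∉ O`. -/
def CondIII (t : K) (f : Polynomial K) (O : Set K) : Prop :=
  ∀ x : K, x ∉ O →
    f.eval x ∈ scale (x ^ f.natDegree) (O \ scale t (mball O)) ∧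
      ∃ u ∈ O, f.eval x = f.leadingCoeff * x ^ f.natDegree + x ^ (f.natDegree - 1) * u

/-- Condition (iv): `O + O ⊆ t⁻¹·O`. -/
def CondIV (t : K) (O : Set K) : Prop := ∀ a ∈ O, ∀ b ∈ O, a + b ∈ scale t⁻¹ O

/-- Assumption (U) for a set `S` of localities and `t ∈ K^×`. -/
def AssumptionU (S : Set (Set K)) (t : K) : Prop :=
  ∃ f : Polynomial K, 2 ≤ f.natDegree ∧
    ∀ v ∈ S, CondI f v ∧ CondII t f v ∧ CondIII t f v ∧ CondIV t v

/-- Assumption (U-exc) for finitely many sets `S 1, …, S n` of localities and `t ∈ K^×`: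
conditions (i), (iii), (iv) everywhere, and condition (ii) on the infinite `S i`. -/
def AssumptionUExc {n : ℕ} (S : Fin n → Set (Set K)) (t : K) : Prop :=
  ∃ f : Polynomial K, 2 ≤ f.natDegree ∧
    (∀ i, ∀ v ∈ S i, CondI f v ∧ CondIII t f v ∧ CondIV t v) ∧
      ∀ i, (S i).Infinite → ∀ v ∈ S i, CondII t f v

/-- `S_π^e(K)`: valuation rings whose value group has a smallest positive element `γ`
(multiplicatively: a largest element `γ < 1`), such that `ℤγ` is convex and
`0 < v(π) ≤ eγ` (multiplicatively `γ^e ≤ v(π) < 1`). -/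
def SPiE (π : K) (e : ℕ) : Set (Set K) :=
  {O | ∃ A : ValuationSubring K, O = (A : Set K) ∧
    ∃ γ : A.ValueGroup, γ ≠ 0 ∧ γ < 1 ∧
      (∀ δ : A.ValueGroup, δ ≠ 0 → δ < 1 → δ ≤ γ) ∧
      (∀ δ : A.ValueGroup, δ ≠ 0 → ∀ m n : ℤ, γ ^ m ≤ δ → δ ≤ γ ^ n → ∃ k : ℤ, δ = γ ^ k) ∧
      A.valuation π < 1 ∧ γ ^ e ≤ A.valuation π}

/-- `O_w` is convex with respect to the ordering with positive cone `P`. -/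
def ConvexWrtOrdering (P W : Set K) : Prop :=
  ∀ u w : K, u ∈ P → w - u ∈ P → w ∈ W → u ∈ W

/-- Iterated application `φ(x₁, φ(x₂, …))`. -/
def iterPhi (φ : K → K → K) : K → List K → K
  | x, [] => x
  | x, y :: l => φ x (iterPhi φ y l)

/-- The holomorphy ring of `T`. -/
def hol (T : Set (Set K)) : Subring K where
  carrier := {y | ∀ A : ValuationSubring K, (A : Set K) ∈ T → y ∈ A}
  zero_mem' := fun A _ => A.zero_mem
  one_mem' := fun A _ => A.one_mem
  add_mem' := fun ha hb A hA => A.add_mem _ _ (ha A hA) (hb A hA)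
  mul_mem' := fun ha hb A hA => A.mul_mem _ _ (ha A hA) (hb A hA)
  neg_mem' := fun ha A hA => A.neg_mem _ (ha A hA)

lemma mem_hol {T : Set (Set K)} {y : K} :
    y ∈ hol T ↔ ∀ A : ValuationSubring K, (A : Set K) ∈ T → y ∈ A := Iff.rfl

lemma hol_anti {T T' : Set (Set K)} (h : T ⊆ T') : hol T' ≤ hol T :=
  fun _ hy A hA => hy A (h hA)

/-- `π` is a uniformizer at each member of `T`. -/
def Good (π : K) (T : Set (Set K)) : Prop :=
  ∀ A : ValuationSubring K, (A : Set K) ∈ T →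
    A.valuation π < 1 ∧ ∀ a, A.valuation a < 1 → A.valuation a ≤ A.valuation π

def Pruf (R : Subring K) : Prop :=
  ∀ x : K, x ≠ 0 → ∃ e ∈ R, e * x ∈ R ∧ (1 - e) / x ∈ R

lemma good_of_SPiE {π : K} (hπ : π ≠ 0) {T : Set (Set K)} (h : T ⊆ SPiE π 1) : Good π T := by
  intro A hA
  obtain ⟨B, hB, γ, h0, h1, h2, -, h4, h5⟩ := h hA
  have hAB : A = B := SetLike.coe_injective hB
  subst hAB
  refine ⟨h4, fun a ha => ?_⟩
  by_cases ha0 : a = 0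
  · simp [ha0]
  · rw [pow_one] at h5
    exact (h2 _ ((A.valuation.ne_zero_iff).2 ha0) ha).trans h5

lemma pruf_hol {π : K} (hπ : π ≠ 0) {T : Set (Set K)} (h : Good π T) : Pruf (hol T) := by
  intro x hx
  have key : ∀ A : ValuationSubring K, (A : Set K) ∈ T →
      π / (π + x ^ 2) ∈ A ∧ π / (π + x ^ 2) * x ∈ A ∧ (1 - π / (π + x ^ 2)) / x ∈ A := by
    intro A hA
    obtain ⟨h1, h2⟩ := h A hA
    have hv0 : 0 < A.valuation π := (zero_lt_iff).2 ((A.valuation.ne_zero_iff).2 hπ)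
    have hx0 : 0 < A.valuation x := (zero_lt_iff).2 ((A.valuation.ne_zero_iff).2 hx)
    have e1 : π + x ^ 2 ≠ 0 → (1 - π / (π + x ^ 2)) / x = x / (π + x ^ 2) := by
      intro h0; field_simp; ring
    simp only [← A.valuation_le_one_iff]
    rcases lt_or_ge (A.valuation x) 1 with hlt | hge
    · have hxp := h2 x hlt
      have hsq : A.valuation (x ^ 2) < A.valuation π := by
        rw [map_pow, pow_two]
        calc A.valuation x * A.valuation x < A.valuation x * 1 := by
              exact mul_lt_mul_of_pos_left hlt hx0
          _ ≤ _ := by simpa using hxp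
      have hs : A.valuation (π + x ^ 2) = A.valuation π :=
        Valuation.map_add_eq_of_lt_left _ hsq
      have hne : π + x ^ 2 ≠ 0 := by
        rw [← A.valuation.ne_zero_iff, hs]; exact hv0.ne'
      rw [e1 hne]
      simp only [map_mul, map_div₀, hs]
      rw [div_self hv0.ne']
      refine ⟨le_rfl, by simpa using hlt.le, ?_⟩
      exact (div_le_one₀ hv0).2 hxp
    · have hsq1 : 1 ≤ A.valuation x * A.valuation x := one_le_mul hge hge
      have hs : A.valuation (π + x ^ 2) = A.valuation x * A.valuation x := by
        rw [← pow_two, ← map_pow]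
        apply Valuation.map_add_eq_of_lt_right
        rw [map_pow, pow_two]
        exact h1.trans_le hsq1
      have hpos : 0 < A.valuation x * A.valuation x := mul_pos hx0 hx0
      have hne : π + x ^ 2 ≠ 0 := by
        rw [← A.valuation.ne_zero_iff, hs]; exact hpos.ne'
      have hle : A.valuation x ≤ A.valuation x * A.valuation x := le_mul_of_one_le_left' hge
      rw [e1 hne]
      simp only [map_mul, map_div₀, hs]
      refine ⟨(div_le_one₀ hpos).2 (h1.le.trans hsq1), ?_, (div_le_one₀ hpos).2 hle⟩
      rw [div_mul_eq_mul_div, div_le_one₀ hpos]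
      exact mul_le_mul' (h1.le.trans hge) le_rfl
  exact ⟨π / (π + x ^ 2), fun A hA => (key A hA).1, fun A hA => (key A hA).2.1,
    fun A hA => (key A hA).2.2⟩

/-- `O_v` is a localization of the holomorphy ring. -/
lemma loc_hol {T : Set (Set K)} (h : Pruf (hol T)) (A : ValuationSubring K)
    (hA : (A : Set K) ∈ T) (y : K) (hy : y ∈ A) :
    ∃ s ∈ hol T, A.valuation s = 1 ∧ s * y ∈ hol T := by
  by_cases hy0 : y = 0
  · exact ⟨1, one_mem _, map_one _, by simpa [hy0] using zero_mem _⟩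
  obtain ⟨e, he, hex, hex'⟩ := h y hy0
  have hle : A.valuation e ≤ 1 := (A.valuation_le_one_iff _).2 (he A hA)
  rcases hle.lt_or_eq with hlt | heq
  · have h1 : A.valuation (1 - e) = 1 := Valuation.map_one_sub_of_lt _ hlt
    refine ⟨(1 - e) / y, hex', ?_, ?_⟩
    · apply le_antisymm ((A.valuation_le_one_iff _).2 (hex' A hA))
      rw [map_div₀, h1, one_div]
      exact (one_le_inv₀ (zero_lt_iff.2 ((A.valuation.ne_zero_iff).2 hy0))).2
        ((A.valuation_le_one_iff _).2 hy)
    · rw [div_mul_cancel₀ _ hy0]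
      exact sub_mem (one_mem _) he
  · exact ⟨e, he, heq, hex⟩

/-- A nonempty finite family of nonzero elements has a generator locally at a prime. -/
lemma fg_local {R : Subring K} (h : Pruf R) (p : Ideal R) [p.IsPrime] {ι : Type*} (s : Finset ι)
    (hs : s.Nonempty) (g : ι → K) (hg : ∀ i ∈ s, g i ≠ 0) :
    ∃ k ∈ s, ∃ u : R, u ∉ p ∧ ∀ i ∈ s, (u : K) * g i / g k ∈ R := by
  classical
  induction hs using Finset.Nonempty.cons_induction with
  | singleton a =>
    refine ⟨a, by simp, 1, ?_, ?_⟩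
    · exact fun h1 => (Ideal.IsPrime.ne_top ‹_›) ((Ideal.eq_top_iff_one _).2 h1)
    · intro i hi
      have : i = a := by simpa using hi
      subst this
      rw [mul_div_assoc, div_self (hg _ hi)]
      simpa using one_mem R
  | cons a s ha hs ih =>
    obtain ⟨k, hk, u, hu, hall⟩ := ih (fun i hi => hg i (by simp [hi]))
    have hgk : g k ≠ 0 := hg k (by simp [hk])
    have hga : g a ≠ 0 := hg a (by simp)
    obtain ⟨e, he, he1, he2⟩ := h (g a / g k) (div_ne_zero hga hgk)
    by_cases hep : (⟨e, he⟩ : R) ∈ p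
    · have h1 : (1 - ⟨e, he⟩ : R) ∉ p := by
        intro h1
        apply (Ideal.IsPrime.ne_top ‹p.IsPrime›)
        rw [Ideal.eq_top_iff_one]
        simpa using add_mem h1 hep
      refine ⟨a, by simp, u * (1 - ⟨e, he⟩), ?_, ?_⟩
      · intro hm
        exact ((Ideal.IsPrime.mem_or_mem ‹_› hm).elim hu h1)
      · intro i hi
        rcases Finset.mem_cons.1 hi with rfl | hi
        · rw [mul_div_assoc, div_self hga, mul_one]
          exact SetLike.coe_mem _
        · have := mul_mem (hall i hi) he2
          convert this using 1
          push_cast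
          field_simp
    · refine ⟨k, by simp [hk], u * ⟨e, he⟩, ?_, ?_⟩
      · intro hm
        exact ((Ideal.IsPrime.mem_or_mem ‹_› hm).elim hu hep)
      · intro i hi
        rcases Finset.mem_cons.1 hi with rfl | hi
        · have := mul_mem u.2 he1
          convert this using 1
          push_cast
          field_simp
        · have := mul_mem (hall i hi) he
          convert this using 1
          push_cast
          field_simp

/-- Every proper ideal of the holomorphy ring of a compact set lies under a member. -/
lemma ideal_le {T : Set (Set K)} (h : Pruf (hol T)) (hval : ∀ v ∈ T, IsValuationLocality v)
    (hT : @IsCompact (Set K) (zarTop K) T) (hne : T.Nonempty)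
    (I : Ideal (hol T)) (hI : I ≠ ⊤) :
    ∃ A : ValuationSubring K, (A : Set K) ∈ T ∧ ∀ a ∈ I, A.valuation (a : K) < 1 := by
  classical
  obtain ⟨p, hp, hIp⟩ := Ideal.exists_le_maximal I hI
  have hpp : p.IsPrime := hp.isPrime
  by_contra hcon
  push Not at hcon
  have hex : ∀ A : ValuationSubring K, (A : Set K) ∈ T →
      ∃ a ∈ p, (a : K) ≠ 0 ∧ (a : K)⁻¹ ∈ A := by
    intro A hA
    obtain ⟨a, ha, hva⟩ := hcon A hA
    have ha0 : (a : K) ≠ 0 := by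
      rintro h0
      rw [h0, map_zero] at hva
      exact absurd hva (by simp)
    refine ⟨a, hIp ha, ha0, ?_⟩
    rw [← A.valuation_le_one_iff, map_inv₀]
    exact inv_le_one_of_one_le₀ hva
  letI := zarTop K
  let P := {a : hol T // a ∈ p ∧ (a : K) ≠ 0}
  obtain ⟨t, ht⟩ := hT.elim_finite_subcover (fun a : P => {O : Set K | (a.1 : K)⁻¹ ∈ O})
    (fun a => TopologicalSpace.GenerateOpen.basic _ ⟨_, rfl⟩) (by
      intro v hv
      obtain ⟨A, rfl⟩ := hval v hv
      obtain ⟨a, ha, ha0, hinv⟩ := hex A hv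
      exact Set.mem_iUnion.2 ⟨⟨a, ha, ha0⟩, hinv⟩)
  rcases t.eq_empty_or_nonempty with rfl | htn
  · have hTe : T = ∅ := by simpa using ht
    exact hne.ne_empty hTe
  obtain ⟨k, hk, u, hu, hall⟩ := fg_local h p t htn (fun a => (a.1 : K)) (fun a _ => a.2.2)
  have hmem : (u : K) / (k.1 : K) ∈ hol T := by
    intro A hA
    obtain ⟨i, hi, hiA⟩ := Set.mem_iUnion₂.1 (ht hA)
    have := A.mul_mem _ _ (hall i hi A hA) hiA
    convert this using 1
    have := i.2.2
    field_simp
  apply hu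
  have : u = ⟨_, hmem⟩ * k.1 := by
    ext
    have := k.2.2
    push_cast
    field_simp
  rw [this]
  exact p.mul_mem_left _ k.2.1

lemma exists_le {T : Set (Set K)} (h : Pruf (hol T)) (hval : ∀ v ∈ T, IsValuationLocality v)
    (hT : @IsCompact (Set K) (zarTop K) T) (hne : T.Nonempty)
    (W : ValuationSubring K) (hW : hol T ≤ W.toSubring) :
    ∃ A : ValuationSubring K, (A : Set K) ∈ T ∧ A ≤ W := by
  let I : Ideal (hol T) := (IsLocalRing.maximalIdeal W).comap (Subring.inclusion hW)
  have hmem : ∀ a : hol T, a ∈ I ↔ W.valuation (a : K) < 1 := by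
    intro a
    exact W.valuation_lt_one_iff (Subring.inclusion hW a)
  have hI : I ≠ ⊤ := by
    rw [Ne, Ideal.eq_top_iff_one, hmem]
    simp
  obtain ⟨A, hA, hAI⟩ := ideal_le h hval hT hne I hI
  refine ⟨A, hA, fun y hy => ?_⟩
  obtain ⟨s, hs, hs1, hsy⟩ := loc_hol h A hA y hy
  have hs' : ¬ W.valuation s < 1 := by
    intro hlt
    have := hAI ⟨s, hs⟩ ((hmem _).2 hlt)
    exact absurd hs1 this.ne
  have h1 : W.valuation s = 1 :=
    le_antisymm ((W.valuation_le_one_iff _).2 (hW hs)) (not_lt.1 hs')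
  have h2 : W.valuation (s * y) ≤ 1 := (W.valuation_le_one_iff _).2 (hW hsy)
  rw [map_mul, h1, one_mul] at h2
  exact (W.valuation_le_one_iff _).1 h2

/-- A proper coarsening of `A` inverts `π`. -/
lemma inv_mem_of_not_le {π : K} (hπ : π ≠ 0) {T : Set (Set K)} (h : Good π T)
    (A : ValuationSubring K) (hA : (A : Set K) ∈ T) (W : ValuationSubring K) (hAW : A ≤ W)
    (hn : ¬ W ≤ A) : π⁻¹ ∈ W := by
  obtain ⟨y, hyW, hyA⟩ := SetLike.not_le_iff_exists.1 hn
  have hy0 : y ≠ 0 := by rintro rfl; exact hyA A.zero_mem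
  have h1 : 1 < A.valuation y := by
    rw [← not_le, A.valuation_le_one_iff]; exact hyA
  have h2 : A.valuation y⁻¹ < 1 := by
    rw [map_inv₀]; exact inv_lt_one_of_one_lt₀ h1
  have h3 := (h A hA).2 _ h2
  have h4 : y⁻¹ / π ∈ A := by
    rw [← A.valuation_le_one_iff, map_div₀]
    exact (div_le_one₀ (zero_lt_iff.2 ((A.valuation.ne_zero_iff).2 hπ))).2 h3
  have := W.mul_mem _ _ hyW (hAW h4)
  convert this using 1
  field_simp

/-- The local statement at one member of `S`. -/
lemma local_step {π : K} (hπ : π ≠ 0) {S T : Set (Set K)} (hS : Good π S) (hT : Good π T)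
    (hval : ∀ v ∈ T, IsValuationLocality v) (hc : @IsCompact (Set K) (zarTop K) T)
    (hdisj : ∀ v, v ∈ S → v ∉ T) (d z : K) (hz : z ≠ 0)
    (hI : ∀ W : Set K, IsValuationLocality W → (∃ v ∈ S, v ⊆ W) → (∃ v ∈ T, v ⊆ W) →
      d ∈ scale z W) (A : ValuationSubring K) (hA : (A : Set K) ∈ S) :
    ∃ s ∈ hol (S ∪ T), A.valuation s = 1 ∧ s * d / (π * z) ∈ hol T := by
  rcases T.eq_empty_or_nonempty with rfl | hne
  · exact ⟨1, one_mem _, map_one _, fun B hB => absurd hB (by simp)⟩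
  have hST : Good π (S ∪ T) := fun B hB => hB.elim (hS B) (hT B)
  have hle : hol (S ∪ T) ≤ hol T := hol_anti Set.subset_union_right
  let R : Subring K :=
    { carrier := {y | ∃ s ∈ hol (S ∪ T), A.valuation s = 1 ∧ s * y ∈ hol T}
      zero_mem' := ⟨1, one_mem _, map_one _, by simpa using zero_mem _⟩
      one_mem' := ⟨1, one_mem _, map_one _, by simpa using one_mem _⟩
      add_mem' := by
        rintro a b ⟨s, hs, hs1, hsa⟩ ⟨t, ht, ht1, htb⟩
        refine ⟨s * t, mul_mem hs ht, by simp [hs1, ht1], ?_⟩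
        have := add_mem (mul_mem (hle ht) hsa) (mul_mem (hle hs) htb)
        convert this using 1
        ring
      mul_mem' := by
        rintro a b ⟨s, hs, hs1, hsa⟩ ⟨t, ht, ht1, htb⟩
        refine ⟨s * t, mul_mem hs ht, by simp [hs1, ht1], ?_⟩
        have := mul_mem hsa htb
        convert this using 1
        ring
      neg_mem' := by
        rintro a ⟨s, hs, hs1, hsa⟩
        exact ⟨s, hs, hs1, by simpa using neg_mem hsa⟩ }
  have hAR : ∀ y ∈ A, y ∈ R := by
    intro y hy
    obtain ⟨s, hs, hs1, hsy⟩ := loc_hol (pruf_hol hπ hST) A (Or.inl hA) y hy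
    exact ⟨s, hs, hs1, hle hsy⟩
  let W : ValuationSubring K :=
    { R with mem_or_inv_mem' := fun y => (A.mem_or_inv_mem y).imp (hAR _) (hAR _) }
  have hAW : A ≤ W := hAR
  obtain ⟨B, hB, hBW⟩ := exists_le (pruf_hol hπ hT) hval hc hne W
    (fun y hy => ⟨1, one_mem _, map_one _, by simpa using hy⟩)
  have hpi : π⁻¹ ∈ W := by
    apply inv_mem_of_not_le hπ hS A hA W hAW
    intro hWA
    have hBA : B ≤ A := hBW.trans hWA
    by_cases hAB : A ≤ B
    · have : A = B := le_antisymm hAB hBA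
      subst this
      exact hdisj _ hA hB
    · have h1 := inv_mem_of_not_le hπ hT B hB A hBA hAB
      rw [← A.valuation_le_one_iff, map_inv₀] at h1
      have h2 := (hS A hA).1
      have h0 : 0 < A.valuation π := zero_lt_iff.2 ((A.valuation.ne_zero_iff).2 hπ)
      exact absurd h1 (not_le.2 ((one_lt_inv₀ h0).2 h2))
  obtain ⟨w, hw, hd⟩ := hI W ⟨W, rfl⟩ ⟨A, hA, hAW⟩ ⟨B, hB, hBW⟩
  obtain ⟨s, hs, hs1, hsd⟩ : π⁻¹ * w ∈ R := W.mul_mem _ _ hpi hw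
  refine ⟨s, hs, hs1, ?_⟩
  convert hsd using 1
  rw [hd]
  field_simp

/-- The subgroup `z·R` of `K`. -/
def modl (z : K) (R : Subring K) : AddSubgroup K where
  carrier := {y | y / z ∈ R}
  zero_mem' := by simpa using zero_mem R
  add_mem' := fun {a b} ha hb => by
    simp only [Set.mem_setOf_eq, add_div] at *
    exact add_mem ha hb
  neg_mem' := fun {a} ha => by
    simp only [Set.mem_setOf_eq, neg_div] at *
    exact neg_mem ha

lemma mem_modl {z y : K} {R : Subring K} : y ∈ modl z R ↔ y / z ∈ R := Iff.rfl

lemma modl_mul {z y h : K} {R : Subring K} (hh : h ∈ R) (hy : y ∈ modl z R) :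
    h * y ∈ modl z R := by
  rw [mem_modl] at *
  rw [mul_div_assoc]
  exact mul_mem hh hy

lemma sup_mul {R : Subring K} {M N : AddSubgroup K} (hM : ∀ h ∈ R, ∀ y ∈ M, h * y ∈ M)
    (hN : ∀ h ∈ R, ∀ y ∈ N, h * y ∈ N) : ∀ h ∈ R, ∀ y ∈ M ⊔ N, h * y ∈ M ⊔ N := by
  intro h hh y hy
  obtain ⟨a, ha, b, hb, rfl⟩ := AddSubgroup.mem_sup.1 hy
  rw [mul_add]
  exact AddSubgroup.add_mem_sup (hM h hh a ha) (hN h hh b hb)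

/-- The pairwise compatibility. -/
lemma pair_step {π : K} (hπ : π ≠ 0) {S T : Set (Set K)} (hS : Good π S) (hT : Good π T)
    (hvS : ∀ v ∈ S, IsValuationLocality v) (hcS : @IsCompact (Set K) (zarTop K) S)
    (hvT : ∀ v ∈ T, IsValuationLocality v) (hcT : @IsCompact (Set K) (zarTop K) T)
    (hdisj : ∀ v, v ∈ S → v ∉ T) (d z z' : K) (hz : z ≠ 0) (hz' : z' ≠ 0)
    (hI : ∀ W : Set K, IsValuationLocality W → (∃ v ∈ S, v ⊆ W) → (∃ v ∈ T, v ⊆ W) →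
      d ∈ scale z W ∧ d ∈ scale z' W) :
    d ∈ modl (π * z) (hol S) ⊔ modl (π * z') (hol T) := by
  have hST : Good π (S ∪ T) := fun B hB => hB.elim (hS B) (hT B)
  have hleT : hol (S ∪ T) ≤ hol T := hol_anti Set.subset_union_right
  have hleS : hol (S ∪ T) ≤ hol S := hol_anti Set.subset_union_left
  set N := modl (π * z) (hol S) ⊔ modl (π * z') (hol T) with hN
  have hmul : ∀ h ∈ hol (S ∪ T), ∀ y ∈ N, h * y ∈ N :=
    sup_mul (fun h hh y hy => modl_mul (hleS hh) hy) (fun h hh y hy => modl_mul (hleT hh) hy)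
  let I : Ideal (hol (S ∪ T)) :=
    { carrier := {h | (h : K) * d ∈ N}
      zero_mem' := by simp
      add_mem' := fun {a b} ha hb => by
        simp only [Set.mem_setOf_eq, Subring.coe_add, add_mul] at *
        exact add_mem ha hb
      smul_mem' := fun c a ha => by
        simp only [Set.mem_setOf_eq, smul_eq_mul, Subring.coe_mul, mul_assoc] at *
        exact hmul _ c.2 _ ha }
  have hmemI : ∀ h : hol (S ∪ T), h ∈ I ↔ (h : K) * d ∈ N := fun _ => Iff.rfl
  by_cases htop : I = ⊤
  · have := (Ideal.eq_top_iff_one I).1 htop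
    rw [hmemI] at this
    simpa using this
  rcases (S ∪ T).eq_empty_or_nonempty with hem | hne
  · apply (le_sup_left : _ ≤ N)
    intro B hB
    have : (B : Set K) ∈ S ∪ T := Or.inl hB
    rw [hem] at this
    exact absurd this (by simp)
  exfalso
  obtain ⟨A, hA, hAI⟩ := ideal_le (pruf_hol hπ hST) (fun v hv => hv.elim (hvS v) (hvT v))
    (@IsCompact.union _ (zarTop K) _ _ hcS hcT) hne I htop
  rcases hA with hA | hA
  · obtain ⟨s, hs, hs1, hsd⟩ := local_step hπ hS hT hvT hcT hdisj d z' hz'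
      (fun W h1 h2 h3 => (hI W h1 h2 h3).2) A hA
    have := hAI ⟨s, hs⟩ ((hmemI _).2 ((le_sup_right : _ ≤ N) hsd))
    exact absurd hs1 this.ne
  · obtain ⟨s, hs, hs1, hsd⟩ := local_step hπ hT hS hvS hcS (fun v h1 h2 => hdisj v h2 h1) d z hz
      (fun W h1 h2 h3 => (hI W h1 h3 h2).1) A hA
    rw [Set.union_comm] at hs
    have := hAI ⟨s, hs⟩ ((hmemI _).2 ((le_sup_left : _ ≤ N) hsd))
    exact absurd hs1 this.ne

lemma distrib {R : Subring K} (h : Pruf R) {A B C : AddSubgroup K}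
    (hA : ∀ h ∈ R, ∀ y ∈ A, h * y ∈ A) (hB : ∀ h ∈ R, ∀ y ∈ B, h * y ∈ B)
    (hC : ∀ h ∈ R, ∀ y ∈ C, h * y ∈ C) {y : K} (h1 : y ∈ A ⊔ C) (h2 : y ∈ B ⊔ C) :
    y ∈ (A ⊓ B) ⊔ C := by
  obtain ⟨a, ha, c, hc, hac⟩ := AddSubgroup.mem_sup.1 h1
  obtain ⟨b, hb, c', hc', hbc⟩ := AddSubgroup.mem_sup.1 h2
  by_cases ha0 : a = 0
  · apply (le_sup_right : C ≤ (A ⊓ B) ⊔ C)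
    rw [← hac, ha0, zero_add]; exact hc
  by_cases hb0 : b = 0
  · apply (le_sup_right : C ≤ (A ⊓ B) ⊔ C)
    rw [← hbc, hb0, zero_add]; exact hc'
  obtain ⟨e, he, he1, he2⟩ := h (b / a) (div_ne_zero hb0 ha0)
  have he' : 1 - e ∈ R := sub_mem (one_mem _) he
  have hy : y = (e * b + (1 - e) * a) + (e * c' + (1 - e) * c) := by
    linear_combination (-e) * hbc - (1 - e) * hac
  rw [hy]
  refine AddSubgroup.add_mem_sup (add_mem ⟨?_, hB e he b hb⟩ ⟨hA _ he' a ha, ?_⟩)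
    (add_mem (hC e he _ hc') (hC _ he' _ hc))
  · have := hA _ he1 a ha
    have e1 : e * b = e * (b / a) * a := by field_simp
    exact e1 ▸ this
  · have := hB _ he2 b hb
    have e1 : (1 - e) * a = (1 - e) / (b / a) * b := by field_simp
    exact e1 ▸ this

lemma crt {R : Subring K} (h : Pruf R) {ι : Type*} (M : ι → AddSubgroup K)
    (hM : ∀ i, ∀ h ∈ R, ∀ y ∈ M i, h * y ∈ M i) (x : ι → K)
    (hx : ∀ i j, x i - x j ∈ M i ⊔ M j) (s : Finset ι) :
    ∃ a : K, ∀ i ∈ s, a - x i ∈ M i := by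
  classical
  have hinf : ∀ s : Finset ι, ∀ h ∈ R, ∀ y ∈ s.inf M, h * y ∈ s.inf M := by
    intro s h hh y hy
    induction s using Finset.induction_on with
    | empty => simp
    | insert a s _ ih =>
      rw [Finset.inf_insert] at hy ⊢
      exact ⟨hM a h hh y hy.1, ih hy.2⟩
  have hdist : ∀ (s : Finset ι) (j : ι) (y : K), (∀ i ∈ s, y ∈ M i ⊔ M j) →
      y ∈ s.inf M ⊔ M j := by
    intro s j y hy
    induction s using Finset.induction_on with
    | empty => simp
    | insert a s _ ih =>
      rw [Finset.inf_insert]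
      exact distrib h (hM a) (hinf s) (hM j) (hy a (by simp))
        (ih fun i hi => hy i (by simp [hi]))
  induction s using Finset.induction_on with
  | empty => exact ⟨0, by simp⟩
  | insert j s _ ih =>
    obtain ⟨a, ha⟩ := ih
    have h1 : x j - a ∈ s.inf M ⊔ M j := by
      apply hdist
      intro i hi
      have h2 := sub_mem (neg_mem (hx i j)) ((le_sup_left : M i ≤ M i ⊔ M j) (ha i hi))
      convert h2 using 1
      ring
    obtain ⟨m, hm, c, hc, hmc⟩ := AddSubgroup.mem_sup.1 h1
    refine ⟨a + m, fun i hi => ?_⟩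
    rcases Finset.mem_insert.1 hi with rfl | hi
    · have := neg_mem hc
      convert this using 1
      linear_combination hmc
    · have := add_mem (ha i hi) ((Finset.inf_le hi : s.inf M ≤ M i) hm)
      convert this using 1
      ring

/-- **Theorem 1.5** (Ershov-type, common uniformizer): pairwise disjoint Zariski-compact
sets of valuation rings with a common uniformizer `π`, compatible data; then strict
simultaneous approximation holds. -/
theorem approx_common_uniformizer {K : Type*} [Field K] (n : ℕ) (S : Fin n → Set (Set K))
    (hval : ∀ i, ∀ v ∈ S i, IsValuationLocality v)
    (hdisj : ∀ i j, i ≠ j → ∀ v, v ∈ S i → v ∉ S j)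
    (x z : Fin n → K) (hz : ∀ i, z i ≠ 0)
    (π : K) (hπ : π ≠ 0) (hU : ∀ i, S i ⊆ SPiE π 1)
    (hT : ∀ i, @IsCompact (Set K) (zarTop K) (S i))
    (hI : ∀ i j, ∀ W : Set K, IsValuationLocality W →
      (∃ v ∈ S i, v ⊆ W) → (∃ v ∈ S j, v ⊆ W) →
      x i - x j ∈ scale (z i) W ∧ scale (z i) W = scale (z j) W) :
    ∃ a : K, ∀ i, ∀ v ∈ S i, (a - x i) / z i ∈ mball v := by
  have hG : ∀ i, Good π (S i) := fun i => good_of_SPiE hπ (hU i)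
  have hGU : Good π (⋃ i, S i) := by
    intro A hA
    obtain ⟨i, hi⟩ := Set.mem_iUnion.1 hA
    exact hG i A hi
  obtain ⟨a, ha⟩ := crt (pruf_hol hπ hGU) (fun i => modl (π * z i) (hol (S i)))
    (fun i h hh y hy => modl_mul (hol_anti (Set.subset_iUnion S i) hh) hy) x (by
      intro i j
      by_cases hij : i = j
      · subst hij
        rw [sub_self]
        exact zero_mem _
      · refine pair_step hπ (hG i) (hG j) (hval i) (hT i) (hval j) (hT j) (hdisj i j hij) _ _ _
          (hz i) (hz j) ?_
        intro W h1 h2 h3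
        obtain ⟨h4, h5⟩ := hI i j W h1 h2 h3
        exact ⟨h4, h5 ▸ h4⟩) Finset.univ
  refine ⟨a, fun i v hv => ?_⟩
  obtain ⟨A, rfl⟩ := hval i v hv
  have h1 : (a - x i) / (π * z i) ∈ A := ha i (Finset.mem_univ i) A hv
  have h2 := (hG i A hv).1
  have h3 : A.valuation ((a - x i) / z i) < 1 := by
    have h4 : (a - x i) / z i = π * ((a - x i) / (π * z i)) := by
      have := hz i
      field_simp
    rw [h4, map_mul]
    exact mul_lt_one_of_lt_of_le h2 ((A.valuation_le_one_iff _).2 h1)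
  refine ⟨(A.valuation_le_one_iff _).1 h3.le, ?_⟩
  rintro ⟨-, h0, hinv⟩
  have h5 : A.valuation ((a - x i) / z i)⁻¹ ≤ 1 := (A.valuation_le_one_iff _).2 hinv
  rw [map_inv₀] at h5
  exact absurd h5 (not_le.2 ((one_lt_inv₀ (zero_lt_iff.2 ((A.valuation.ne_zero_iff).2 h0))).2 h3))

end PaperApprox
end

section
/- Let K be a field, let S_1, …, S_n be pairwise disjoint sets of orderings of K, and let x_1, …, x_n ∈ K, z_1, …, z_n ∈ K^×. Assume: (T) each S_i is compact in the Harrison topology on the set of orderings of K; (I) whenever a valuation ring O_w of K is convex both with respect to an ordering P ∈ S_i and with respect to an ordering Q ∈ S_j with i ≠ j, then P and Q induce distinct orderings on the residue field O_w/m_w, and x_i − x_j ∈ z_i·O_w and z_i·O_w = z_j·O_w. Then there exists x ∈ K with (x − x_i)^2 <_P z_i^2 for all P ∈ S_i, for i = 1, …, n. -/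
namespace PaperApprox

variable {K : Type*} [Field K]

theorem cone_model {K : Type*} [Field K] {P : Set K} (hP : IsOrderingCone P) :
    ∃ (_ : LinearOrder K), (IsStrictOrderedRing K) ∧ ∀ a b : K, a ≤ b ↔ b - a ∈ P := by
  obtain ⟨hadd, hmul, htot, hzero⟩ := hP
  have h0 : (0 : K) ∈ P := by
    rcases htot 0 with h | h
    · exact h
    · simpa using h
  have h1 : (1 : K) ∈ P := by
    rcases htot 1 with h | h
    · exact h
    · simpa using hmul _ h _ h
  let o : LinearOrder K :=
    { le := fun a b => b - a ∈ P
      le_refl := fun a => by simpa using h0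
      le_trans := fun a b c hab hbc => by
        have := hadd _ hab _ hbc
        show c - a ∈ P
        convert this using 1; ring
      le_antisymm := fun a b hab hba => by
        have := hzero _ hab (by rw [neg_sub]; exact hba)
        exact (sub_eq_zero.mp this).symm
      le_total := fun a b => by
        rcases htot (b - a) with h | h
        · exact Or.inl h
        · right
          rw [neg_sub] at h; exact h
      toDecidableLE := Classical.decRel _ }
  have hle : ∀ a b : K, a ≤ b ↔ b - a ∈ P := fun a b => Iff.rfl
  refine ⟨o, ?_, hle⟩
  have : IsOrderedAddMonoid K :=
    { add_le_add_left := fun a b hab c => by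
        rw [hle] at hab ⊢
        convert hab using 1; ring }
  have : ZeroLEOneClass K := ⟨by rw [hle]; simpa using h1⟩
  refine IsStrictOrderedRing.of_mul_pos ?_
  intro a b ha hb
  refine lt_of_le_of_ne ?_ (mul_ne_zero ha.ne' hb.ne').symm
  have ha' := (hle _ _).1 ha.le
  have hb' := (hle _ _).1 hb.le
  rw [hle]
  simpa using hmul _ ha' _ hb'

universe u

theorem cone_model' {K : Type u} [Field K] {P : Set K} (hP : IsOrderingCone P) :
    ∃ (L : Type u) (_ : Field L) (_ : LinearOrder L) (_ : IsStrictOrderedRing L) (f : K →+* L),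
      (∀ a, a ∈ P ↔ 0 ≤ f a) ∧ ∀ a b, coneLT P a b ↔ f a < f b := by
  obtain ⟨o, ho, hle⟩ := cone_model hP
  refine ⟨K, inferInstance, o, ho, RingHom.id K, ?_, ?_⟩
  · intro a
    rw [RingHom.id_apply, hle]; simp
  · intro a b
    rw [lt_iff_le_and_ne]
    simp only [RingHom.id_apply, hle, coneLT]

section core
variable {K L M : Type*} [Field K] [Field L] [LinearOrder L] [IsStrictOrderedRing L]
  [Field M] [LinearOrder M] [IsStrictOrderedRing M]

/-- convexity along a homomorphism to an ordered field -/
def FConv (f : K →+* L) (W : ValuationSubring K) : Prop :=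
  ∀ u w : K, 0 ≤ f u → f u ≤ f w → w ∈ W → u ∈ W

theorem core_inf (f : K →+* L) (g : K →+* M) (d : K) (hg : 1 ≤ g d)
    (hinf : ∀ n : ℕ, (n : L) < f d)
    (H : ∀ W : ValuationSubring K, FConv f W → FConv g W → d ∈ W) :
    ∃ y : K, f d ≤ |f y| ∧ |g y| * g d ≤ 1 := by
  by_contra hno
  push Not at hno
  have h1 : (1 : L) < f d := by simpa using hinf 1
  have h0 : (0 : L) < f d := by linarith
  have hsmall : ∀ y : K, |f y| ≤ 1 → ∀ n : ℕ, |f y| ^ n < f d := fun y hy n =>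
    lt_of_le_of_lt (pow_le_one₀ (abs_nonneg _) hy) h1
  let W : ValuationSubring K :=
    { carrier := {y | ∀ n : ℕ, |f y| ^ n < f d}
      zero_mem' := hsmall 0 (by simp)
      one_mem' := hsmall 1 (by simp)
      neg_mem' := fun {y} hy n => by simpa using hy n
      mul_mem' := fun {a b} ha hb n => by
        have ha := ha (2 * n)
        have hb := hb (2 * n)
        rw [map_mul, abs_mul, mul_pow]
        refine lt_of_pow_lt_pow_left₀ 2 h0.le ?_
        rw [mul_pow, ← pow_mul, ← pow_mul, sq, mul_comm n 2]
        exact mul_lt_mul'' ha hb (by positivity) (by positivity)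
      add_mem' := fun {a b} ha hb n => by
        have hm : (max |f a| |f b|) ^ (2 * n) < f d := by
          rcases max_choice |f a| |f b| with h | h <;> rw [h]
          · exact ha _
          · exact hb _
        have hab : |f (a + b)| ≤ 2 * max |f a| |f b| := by
          rw [map_add]
          have := abs_add_le (f a) (f b)
          have := le_max_left |f a| |f b|
          have := le_max_right |f a| |f b|
          linarith
        have hn : (2 : L) ^ (2 * n) < f d := by
          have := hinf (2 ^ (2 * n))
          push_cast at this
          exact this
        refine lt_of_pow_lt_pow_left₀ 2 h0.le ?_
        rw [← pow_mul, mul_comm n 2, sq]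
        calc |f (a + b)| ^ (2 * n) ≤ (2 * max |f a| |f b|) ^ (2 * n) :=
              pow_le_pow_left₀ (abs_nonneg _) hab _
          _ = 2 ^ (2 * n) * (max |f a| |f b|) ^ (2 * n) := mul_pow _ _ _
          _ < f d * f d := by
            apply mul_lt_mul'' hn hm (by positivity) (by positivity)
      mem_or_inv_mem' := fun y => by
        rcases le_total |f y| 1 with h | h
        · exact Or.inl (hsmall y h)
        · refine Or.inr (hsmall _ ?_)
          rw [map_inv₀, abs_inv]
          exact inv_le_one_of_one_le₀ h }
  have hW : ∀ y, y ∈ W ↔ ∀ n : ℕ, |f y| ^ n < f d := fun y => Iff.rfl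
  have hdW := H W ?_ ?_
  · have := (hW d).1 hdW 1
    rw [pow_one, abs_of_pos h0] at this
    exact lt_irrefl _ this
  · intro u w hu huw hw
    rw [hW] at hw ⊢
    intro n
    refine lt_of_le_of_lt (pow_le_pow_left₀ (abs_nonneg _) ?_ n) (hw n)
    rw [abs_of_nonneg hu, abs_of_nonneg (hu.trans huw)]
    exact huw
  · intro u w hu huw hw
    by_contra hu'
    rw [hW] at hw hu'
    push Not at hu'
    obtain ⟨n, hn⟩ := hu'
    have hw0 : w ≠ 0 := by
      rintro rfl
      have h3 : g u = 0 := le_antisymm (by simpa using huw) hu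
      have h4 : u = 0 := (map_eq_zero g).1 h3
      subst h4
      exact absurd (hsmall 0 (by simp) n) (not_lt.2 hn)
    have hgw : 0 < g w := lt_of_le_of_ne (hu.trans huw) (Ne.symm ((map_ne_zero g).2 hw0))
    have hfw : 0 < |f w| := abs_pos.2 (by simpa using hw0)
    have hd0 : d ≠ 0 := by rintro rfl; simp at h0
    have key := hno ((u / w) ^ (4 * n) / d ) ?_
    · rw [map_div₀, abs_div, abs_of_pos (by linarith : 0 < g d),
        div_mul_cancel₀ _ (by linarith : g d ≠ 0), map_pow, abs_pow, map_div₀, abs_div,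
        abs_of_nonneg hu, abs_of_pos hgw] at key
      have : g u / g w ≤ 1 := (div_le_one hgw).2 huw
      have h5 : (g u / g w) ^ (4 * n) ≤ 1 := pow_le_one₀ (by positivity) this
      linarith
    · rw [map_div₀, abs_div, map_pow, abs_pow, map_div₀, abs_div, abs_of_pos h0, div_pow,
        le_div_iff₀ h0, le_div_iff₀ (by positivity)]
      have hw4 := hw (4 * n)
      have hu4 : f d ^ 4 ≤ |f u| ^ (4 * n) := by
        rw [mul_comm, pow_mul]
        exact pow_le_pow_left₀ h0.le hn 4
      have : f d * f d * |f w| ^ (4 * n) < f d * f d * f d :=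
        mul_lt_mul_of_pos_left hw4 (by positivity)
      have : f d * f d * f d ≤ f d ^ 4 := by
        have := pow_le_pow_right₀ h1.le (show 3 ≤ 4 by norm_num)
        calc _ = f d ^ 3 := by ring
          _ ≤ _ := this
      linarith

theorem core_fin (f : K →+* L) (g : K →+* M) (d : K) (hg : 1 ≤ g d) (N : ℕ)
    (hfN : f d ≤ N) (hgN : g d ≤ N)
    (H : ∀ W : ValuationSubring K, FConv f W → FConv g W →
      ¬ ∀ y ∈ W, y⁻¹ ∈ W → y ≠ 0 → (0 ≤ f y ↔ 0 ≤ g y)) :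
    ∃ y : K, f d ≤ |f y| ∧ |g y| * g d ≤ 1 := by
  by_contra hno
  push Not at hno
  have hN1 : (1 : M) ≤ N := hg.trans hgN
  have hN0 : 0 < N := by
    have : (0 : M) < N := by linarith
    exact_mod_cast this
  have hNL : (0 : L) < N := by exact_mod_cast hN0
  have hNM : (0 : M) < N := by exact_mod_cast hN0
  -- Claim A
  have cA : ∀ (y : K) (k : ℕ), |g y| ≤ 1 → k * (|f y| - 1) < 1 := by
    intro y k hy
    by_contra hk
    push Not at hk
    have hk0 : 0 < k := by
      rcases Nat.eq_zero_or_pos k with h | h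
      · subst h
        have : ¬ ((1 : L) ≤ 0) := by norm_num
        simp at hk
        exact absurd hk this
      · exact h
    have hkL : (0 : L) < k := by exact_mod_cast hk0
    have hpos : 0 ≤ |f y| - 1 := by
      by_contra hneg
      push Not at hneg
      have := mul_neg_of_pos_of_neg hkL hneg
      linarith
    have hbern : ∀ m : ℕ, 1 + (m : L) * (|f y| - 1) ≤ |f y| ^ m := by
      intro m
      have := one_add_mul_le_pow (a := |f y| - 1) (by linarith) m
      simpa using this
    have hb := hbern (k * (N * N))
    have hbig : (N : L) * N ≤ |f y| ^ (k * (N * N)) := by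
      push_cast at hb
      have : (N : L) * N * 1 ≤ N * N * (k * (|f y| - 1)) :=
        mul_le_mul_of_nonneg_left hk (by positivity)
      linarith
    have key := hno (y ^ (k * (N * N)) / N) ?_
    · rw [map_div₀, abs_div, map_pow, abs_pow, map_natCast, Nat.abs_cast] at key
      have h5 : |g y| ^ (k * (N * N)) ≤ 1 := pow_le_one₀ (abs_nonneg _) hy
      have : |g y| ^ (k * (N * N)) / N * g d ≤ 1 / N * N := by
        apply mul_le_mul _ hgN (by linarith) (by positivity)
        gcongr
      rw [one_div, inv_mul_cancel₀ hNM.ne'] at this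
      linarith
    · rw [map_div₀, abs_div, map_pow, abs_pow, map_natCast, Nat.abs_cast]
      refine hfN.trans ?_
      rw [le_div_iff₀ hNL]
      exact hbig
  have cA2 : ∀ y : K, |g y| ≤ 1 → |f y| < 2 := by
    intro y hy
    have := cA y 1 hy
    push_cast at this
    linarith
  -- Claim B
  have cB : ∀ y : K, |f y| ≤ 1 → |g y| ≤ 2 := by
    intro y hy
    by_contra hgt
    push Not at hgt
    have hy0 : y ≠ 0 := by
      rintro rfl
      simp at hgt
      have : ¬ ((2 : M) < 0) := by norm_num
      exact this hgt
    have hfy : 0 < |f y| := abs_pos.2 ((map_ne_zero f).2 hy0)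
    have h := cA2 (2 * y⁻¹) (by
      rw [map_mul, abs_mul, map_inv₀, abs_inv, map_ofNat, ← div_eq_mul_inv, div_le_one (by linarith)]
      rw [abs_of_pos (by norm_num)]
      exact hgt.le)
    rw [map_mul, abs_mul, map_inv₀, abs_inv, map_ofNat, ← div_eq_mul_inv, div_lt_iff₀ hfy,
      abs_of_pos (by norm_num)] at h
    linarith
  let W : ValuationSubring K :=
    { carrier := {y | ∃ n : ℕ, |f y| ≤ n}
      zero_mem' := ⟨0, by simp⟩
      one_mem' := ⟨1, by simp⟩
      neg_mem' := fun {y} ⟨n, hy⟩ => ⟨n, by simpa using hy⟩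
      mul_mem' := fun {a b} ⟨n, ha⟩ ⟨m, hb⟩ => ⟨n * m, by
        rw [map_mul, abs_mul]
        push_cast
        exact mul_le_mul ha hb (abs_nonneg _) (by positivity)⟩
      add_mem' := fun {a b} ⟨n, ha⟩ ⟨m, hb⟩ => ⟨n + m, by
        rw [map_add]
        push_cast
        exact (abs_add_le _ _).trans (add_le_add ha hb)⟩
      mem_or_inv_mem' := fun y => by
        rcases le_total |f y| 1 with h | h
        · exact Or.inl ⟨1, by simpa using h⟩
        · refine Or.inr ⟨1, ?_⟩
          rw [map_inv₀, abs_inv]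
          simpa using inv_le_one_of_one_le₀ h }
  have hW : ∀ y, y ∈ W ↔ ∃ n : ℕ, |f y| ≤ n := fun y => Iff.rfl
  have hWg : ∀ y ∈ W, ∃ n : ℕ, 0 < n ∧ |f y| ≤ n ∧ |g y| ≤ n := by
    intro y hy
    obtain ⟨n, hn⟩ := (hW y).1 hy
    refine ⟨2 * (n + 1), by omega, ?_, ?_⟩
    · push_cast
      have : (0 : L) ≤ n := by positivity
      linarith
    · have hn1 : (0 : L) < (n : L) + 1 := by positivity
      have hn2 : (0 : M) < (n : M) + 1 := by positivity
      have := cB (y / (n + 1 : ℕ)) (by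
        rw [map_div₀, abs_div, map_natCast, Nat.abs_cast]
        push_cast
        rw [div_le_one hn1]
        linarith)
      rw [map_div₀, abs_div, map_natCast, Nat.abs_cast] at this
      push_cast at this ⊢
      rwa [div_le_iff₀ hn2] at this
  have hsign : ∀ y ∈ W, y⁻¹ ∈ W → y ≠ 0 → 0 ≤ f y → 0 ≤ g y := by
    intro y hy hyi hy0 hfy
    by_contra hgy
    push Not at hgy
    obtain ⟨m, hm0, hm, hm'⟩ := hWg y hy
    obtain ⟨k, hk⟩ := (hW _).1 hyi
    have hmL : (0 : L) < m := by exact_mod_cast hm0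
    have hmM : (0 : M) < m := by exact_mod_cast hm0
    have hfy' : 0 < f y := lt_of_le_of_ne hfy (Ne.symm ((map_ne_zero f).2 hy0))
    have hk1 : 1 ≤ k * f y := by
      rw [map_inv₀, abs_inv, abs_of_pos hfy'] at hk
      rwa [inv_le_iff_one_le_mul₀ hfy'] at hk
    have := cA ((y + m) / m) (k * m) (by
      rw [map_div₀, map_add, map_natCast, abs_div, Nat.abs_cast, div_le_one hmM]
      rw [abs_le] at hm' ⊢
      constructor <;> linarith [hm'.1])
    rw [map_div₀, map_add, map_natCast, abs_div, Nat.abs_cast, abs_of_pos (by linarith)] at this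
    have h2 : ((k * m : ℕ) : L) * ((f y + m) / m - 1) = k * f y := by
      push_cast
      field_simp
      ring
    rw [h2] at this
    linarith
  refine H W ?_ ?_ ?_
  · intro u w hu huw hw
    obtain ⟨n, hn⟩ := (hW w).1 hw
    refine (hW u).2 ⟨n, ?_⟩
    rw [abs_of_nonneg hu]
    exact huw.trans ((le_abs_self _).trans hn)
  · intro u w hu huw hw
    obtain ⟨n, hn⟩ := (hW w).1 hw
    by_cases hw0 : w = 0
    · subst hw0
      have h3 : g u = 0 := le_antisymm (by simpa using huw) hu
      have h4 : u = 0 := (map_eq_zero g).1 h3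
      rw [h4]; exact W.zero_mem
    have hgw : 0 < g w := lt_of_le_of_ne (hu.trans huw) (Ne.symm ((map_ne_zero g).2 hw0))
    have hfw : 0 < |f w| := abs_pos.2 ((map_ne_zero f).2 hw0)
    have := cA2 (u / w) (by
      rw [map_div₀, abs_div, abs_of_nonneg hu, abs_of_pos hgw]
      exact (div_le_one hgw).2 huw)
    rw [map_div₀, abs_div, div_lt_iff₀ hfw] at this
    refine (hW u).2 ⟨2 * n, ?_⟩
    push_cast
    linarith
  · intro y hy hyi hy0
    refine ⟨hsign y hy hyi hy0, fun hgy => ?_⟩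
    by_contra hfy
    push Not at hfy
    have := hsign (-y) (W.neg_mem _ hy) (by rw [inv_neg]; exact W.neg_mem _ hyi)
      (neg_ne_zero.2 hy0) (by rw [map_neg]; linarith)
    rw [map_neg] at this
    have h0 : g y = 0 := by linarith
    exact hy0 ((map_eq_zero g).1 h0)

theorem core (f : K →+* L) (g : K →+* M) (d : K) (hf : 1 ≤ f d) (hg : 1 ≤ g d)
    (H : ∀ W : ValuationSubring K, FConv f W → FConv g W → d ∈ W)
    (H' : ∀ W : ValuationSubring K, FConv f W → FConv g W →
      ¬ ∀ y ∈ W, y⁻¹ ∈ W → y ≠ 0 → (0 ≤ f y ↔ 0 ≤ g y)) :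
    ∃ y : K, y ≠ 0 ∧ f d ≤ |f y| ∧ |g y| * g d ≤ 1 := by
  suffices h : ∃ y : K, f d ≤ |f y| ∧ |g y| * g d ≤ 1 by
    obtain ⟨y, h1, h2⟩ := h
    refine ⟨y, ?_, h1, h2⟩
    rintro rfl
    rw [map_zero, abs_zero] at h1
    linarith
  by_cases h1 : ∀ n : ℕ, (n : L) < f d
  · exact core_inf f g d hg h1 H
  by_cases h2 : ∀ n : ℕ, (n : M) < g d
  · obtain ⟨y, hy1, hy2⟩ := core_inf g f d hf h2 (fun W a b => H W b a)
    have hy0 : y ≠ 0 := by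
      rintro rfl
      rw [map_zero, abs_zero] at hy1
      linarith
    have hfy : 0 < |f y| := abs_pos.2 ((map_ne_zero f).2 hy0)
    have hgy : 0 < |g y| := abs_pos.2 ((map_ne_zero g).2 hy0)
    refine ⟨y⁻¹, ?_, ?_⟩
    · rw [map_inv₀, abs_inv, le_inv_comm₀ (by linarith) hfy]
      rw [← one_div, le_div_iff₀ (by linarith)]
      exact hy2
    · rw [map_inv₀, abs_inv, inv_mul_le_iff₀ hgy]
      linarith
  push Not at h1 h2
  obtain ⟨n, hn⟩ := h1
  obtain ⟨m, hm⟩ := h2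
  refine core_fin f g d hg (max n m) ?_ ?_ H'
  · exact hn.trans (by exact_mod_cast le_max_left n m)
  · exact hm.trans (by exact_mod_cast le_max_right n m)
end core

def TP (h : K) : Prop := ∀ P : Set K, IsOrderingCone P → coneLT P 0 h

def Ge1 (d : K) : Prop := ∀ P : Set K, IsOrderingCone P → d - 1 ∈ P

def Far (A : Set (Set K)) (d : K) (B : Set (Set K)) (e : K) : Prop :=
  ∃ h : K, TP h ∧ (∀ P ∈ A, coneLT P (2 * d) h) ∧ ∀ Q ∈ B, coneLT Q (2 * h * e) 1

theorem ge1_sq (y : K) : Ge1 (1 + y ^ 2) := by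
  intro P hP
  obtain ⟨L, _, _, _, f, hf, hlt⟩ := cone_model' hP
  rw [hf]
  simp only [map_sub, map_add, map_one, map_pow]
  have := sq_nonneg (f y)
  linarith

theorem Far.symm {A B : Set (Set K)} {d e : K} (hA : ∀ P ∈ A, IsOrderingCone P)
    (hB : ∀ P ∈ B, IsOrderingCone P) (h : Far A d B e) : Far B e A d := by
  obtain ⟨h, hp, h1, h2⟩ := h
  refine ⟨h⁻¹, ?_, ?_, ?_⟩
  · intro P hP
    have h3 := hp P hP
    obtain ⟨L, _, _, _, f, hf, hlt⟩ := cone_model' hP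
    rw [hlt, map_zero] at h3 ⊢
    rw [map_inv₀]
    positivity
  · intro P hP
    have h3 := hp P (hB P hP)
    have h4 := h2 P hP
    obtain ⟨L, _, _, _, f, hf, hlt⟩ := cone_model' (hB P hP)
    rw [hlt] at h3 h4 ⊢
    simp only [map_mul, map_zero, map_one, map_inv₀, map_ofNat] at h3 h4 ⊢
    rw [← one_div, lt_div_iff₀ h3]
    linarith
  · intro P hP
    have h3 := hp P (hA P hP)
    have h4 := h1 P hP
    obtain ⟨L, _, _, _, f, hf, hlt⟩ := cone_model' (hA P hP)
    rw [hlt] at h3 h4 ⊢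
    simp only [map_mul, map_zero, map_one, map_inv₀, map_ofNat] at h3 h4 ⊢
    have : 2 * (f h)⁻¹ * f d = (2 * f d) / f h := by field_simp
    rw [this, div_lt_one h3]
    exact h4

theorem TP.oplus {h h' : K} (hp : TP h) (hp' : TP h') : TP (h ^ 2 + h' ^ 2) := by
  intro P hP
  have h1 := hp P hP
  have h2 := hp' P hP
  obtain ⟨L, _, _, _, f, hf, hlt⟩ := cone_model' hP
  rw [hlt] at h1 h2 ⊢
  simp only [map_add, map_zero, map_pow] at h1 h2 ⊢
  positivity

theorem oplus_left {P : Set K} (hP : IsOrderingCone P) {h h' d : K} (hd : Ge1 d)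
    (h1 : coneLT P (2 * d) h) : coneLT P (2 * d) (h ^ 2 + h' ^ 2) := by
  have hd' := hd P hP
  obtain ⟨L, _, _, _, f, hf, hlt⟩ := cone_model' hP
  rw [hlt] at h1 ⊢
  rw [hf] at hd'
  simp only [map_add, map_sub, map_one, map_mul, map_ofNat, map_pow] at h1 hd' ⊢
  nlinarith [sq_nonneg (f h')]

theorem oplus_right {P : Set K} (hP : IsOrderingCone P) {h h' e : K} (he : Ge1 e)
    (hp : TP h) (hp' : TP h')
    (h1 : coneLT P (2 * h * e) 1) (h2 : coneLT P (2 * h' * e) 1) :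
    coneLT P (2 * (h ^ 2 + h' ^ 2) * e) 1 := by
  have he' := he P hP
  have h3 := hp P hP
  have h4 := hp' P hP
  obtain ⟨L, _, _, _, f, hf, hlt⟩ := cone_model' hP
  rw [hlt] at h1 h2 h3 h4 ⊢
  rw [hf] at he'
  simp only [map_add, map_sub, map_one, map_zero, map_mul, map_ofNat, map_pow] at h1 h2 h3 h4 he' ⊢
  have aux : ∀ t : L, 0 < t → 2 * t * f e < 1 → 2 * t ^ 2 * f e < 1 / 2 := by
    intro t ht h
    have h5 : 2 * t < 1 := by nlinarith
    have h6 : 2 * t * f e * t < 1 * t := mul_lt_mul_of_pos_right h ht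
    nlinarith
  have := aux _ h3 h1
  have := aux _ h4 h2
  linarith

theorem far_empty {B : Set (Set K)} (hB : ∀ P ∈ B, IsOrderingCone P) {d e : K} (he : Ge1 e) :
    Far ∅ d B e := by
  refine ⟨(4 * e)⁻¹, ?_, by simp, ?_⟩
  · intro P hP
    have he' := he P hP
    obtain ⟨L, _, _, _, f, hf, hlt⟩ := cone_model' hP
    rw [hf] at he'
    rw [hlt]
    simp only [map_sub, map_one, map_zero, map_mul, map_ofNat, map_inv₀] at he' ⊢
    have : 0 < f e := by linarith
    positivity
  · intro P hP
    have he' := he P (hB P hP)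
    obtain ⟨L, _, _, _, f, hf, hlt⟩ := cone_model' (hB P hP)
    rw [hf] at he'
    rw [hlt]
    simp only [map_sub, map_one, map_zero, map_mul, map_ofNat, map_inv₀] at he' ⊢
    have : 0 < f e := by linarith
    have h2 : 2 * (4 * f e)⁻¹ * f e = 1 / 2 := by field_simp; norm_num
    rw [h2]; norm_num

theorem far_compact {A B : Set (Set K)} (hA : ∀ P ∈ A, IsOrderingCone P)
    (hB : ∀ P ∈ B, IsOrderingCone P) {d e : K} (hd : Ge1 d) (he : Ge1 e)
    (hc : @IsCompact (Set K) (harrisonTop K) A) (h : ∀ P ∈ A, Far {P} d B e) : Far A d B e := by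
  letI := harrisonTop K
  have key : Far (A ∩ A) d B e := by
    refine IsCompact.induction_on (p := fun s => Far (A ∩ s) d B e) hc ?_ ?_ ?_ ?_
    · simpa using far_empty hB he
    · rintro s t hst ⟨h, hp, h1, h2⟩
      exact ⟨h, hp, fun P hP => h1 P ⟨hP.1, hst hP.2⟩, h2⟩
    · rintro s t ⟨h, hp, h1, h2⟩ ⟨h', hp', h1', h2'⟩
      refine ⟨h ^ 2 + h' ^ 2, hp.oplus hp', ?_, ?_⟩
      · rintro P ⟨hPA, hP | hP⟩
        · exact oplus_left (hA P hPA) hd (h1 P ⟨hPA, hP⟩)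
        · rw [add_comm]
          exact oplus_left (hA P hPA) hd (h1' P ⟨hPA, hP⟩)
      · intro Q hQ
        exact oplus_right (hB Q hQ) he hp hp' (h2 Q hQ) (h2' Q hQ)
    · intro P hP
      obtain ⟨h, hp, h1, h2⟩ := h P hP
      have h3 := h1 P rfl
      have hne : h - 2 * d ≠ 0 := sub_ne_zero.2 h3.2.symm
      refine ⟨{P' | h - 2 * d ∈ P'}, mem_nhdsWithin_of_mem_nhds ?_, h, hp, ?_, h2⟩
      · refine IsOpen.mem_nhds ?_ h3.1
        exact TopologicalSpace.isOpen_generateFrom_of_mem ⟨_, hne, rfl⟩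
      · rintro P' ⟨_, hP'⟩
        exact ⟨hP', h3.2⟩
  simpa using key

theorem far_pair {P Q : Set K} (hP : IsOrderingCone P) (hQ : IsOrderingCone Q) {d e : K}
    (hd : Ge1 d) (he : Ge1 e)
    (H : ∀ W : ValuationSubring K, ConvexWrtOrdering P (W : Set K) →
      ConvexWrtOrdering Q (W : Set K) → d ∈ W ∧ e ∈ W ∧
        ¬ SameResidue (W : Set K) (P ∩ W) (Q ∩ W)) :
    Far {P} d {Q} e := by
  have hdP := hd P hP
  have hdQ := hd Q hQ
  have heP := he P hP
  have heQ := he Q hQ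
  obtain ⟨L, _, _, _, f, hf, hfl⟩ := cone_model' hP
  obtain ⟨M, _, _, _, g, hg, hgl⟩ := cone_model' hQ
  rw [hf, map_sub, map_one] at hdP heP
  rw [hg, map_sub, map_one] at hdQ heQ
  have hcf : ∀ W : ValuationSubring K, FConv f W → ConvexWrtOrdering P (W : Set K) := by
    intro W h u w hu hw hwW
    rw [hf] at hu hw
    rw [map_sub] at hw
    exact h u w hu (by linarith) hwW
  have hcg : ∀ W : ValuationSubring K, FConv g W → ConvexWrtOrdering Q (W : Set K) := by
    intro W h u w hu hw hwW
    rw [hg] at hu hw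
    rw [map_sub] at hw
    exact h u w hu (by linarith) hwW
  obtain ⟨y, hy0, hy1, hy2⟩ := core f g (d + d + e + e)
    (by simp only [map_add]; linarith) (by simp only [map_add]; linarith)
    (fun W h1 h2 => by
      obtain ⟨h3, h4, _⟩ := H W (hcf W h1) (hcg W h2)
      exact W.add_mem _ _ (W.add_mem _ _ (W.add_mem _ _ h3 h3) h4) h4)
    (fun W h1 h2 hcontra => by
      obtain ⟨_, _, h5⟩ := H W (hcf W h1) (hcg W h2)
      apply h5
      have h0m : (0 : K) ∈ mball (W : Set K) := ⟨W.zero_mem, fun h => h.2.1 rfl⟩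
      constructor
      · rintro a ⟨haP, haW⟩
        by_cases hm : a ∈ mball (W : Set K)
        · exact ⟨0, ⟨by rw [hg, map_zero], W.zero_mem⟩, by simpa using hm⟩
        · have : a ≠ 0 ∧ a⁻¹ ∈ W := by
            by_contra hh
            exact hm ⟨haW, fun h => hh h.2⟩
          refine ⟨a, ⟨?_, haW⟩, by simpa using h0m⟩
          rw [hg, ← hcontra a haW this.2 this.1, ← hf]
          exact haP
      · rintro a ⟨haP, haW⟩
        by_cases hm : -a ∈ mball (W : Set K)
        · exact ⟨0, ⟨by rw [hf, map_zero], W.zero_mem⟩, by simpa using hm⟩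
        · have : -a ≠ 0 ∧ (-a)⁻¹ ∈ W := by
            by_contra hh
            exact hm ⟨W.neg_mem _ haW, fun h => hh h.2⟩
          have h7 : a⁻¹ ∈ W := by
            have := W.neg_mem _ this.2
            rwa [inv_neg, neg_neg] at this
          refine ⟨a, ⟨?_, haW⟩, by simpa using h0m⟩
          rw [hf, hcontra a haW h7 (neg_ne_zero.1 this.1), ← hg]
          exact haP)
  simp only [map_add] at hy1 hy2
  refine ⟨y ^ 2, ?_, ?_, ?_⟩
  · intro P' hP'
    obtain ⟨L', _, _, _, f', hf', hfl'⟩ := cone_model' hP'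
    rw [hfl', map_zero, map_pow]
    have : f' y ≠ 0 := (map_ne_zero f').2 hy0
    positivity
  · rintro P' rfl
    rw [hfl]
    simp only [map_mul, map_pow, map_ofNat]
    rw [← sq_abs]
    nlinarith
  · rintro P' rfl
    rw [hgl]
    simp only [map_mul, map_pow, map_ofNat, map_one]
    rw [← sq_abs]
    have h8 := abs_pos.2 ((map_ne_zero g).2 hy0)
    set t := |g y|
    have h9 : t * 4 ≤ 1 := by nlinarith
    have h10 : t * (t * (g d + g d + g e + g e)) ≤ t * 1 := mul_le_mul_of_nonneg_left hy2 h8.le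
    have h11 : 0 < t * t * g d := by
      have : 0 < g d := by linarith
      positivity
    nlinarith

theorem far_sets {A B : Set (Set K)} (hA : ∀ P ∈ A, IsOrderingCone P)
    (hB : ∀ P ∈ B, IsOrderingCone P) {d e : K} (hd : Ge1 d) (he : Ge1 e)
    (hcA : @IsCompact (Set K) (harrisonTop K) A) (hcB : @IsCompact (Set K) (harrisonTop K) B)
    (h : ∀ P ∈ A, ∀ Q ∈ B, Far {P} d {Q} e) : Far A d B e := by
  refine far_compact hA hB hd he hcA fun P hP => ?_
  have hP' : ∀ P' ∈ ({P} : Set (Set K)), IsOrderingCone P' := by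
    rintro P' rfl; exact hA _ hP
  refine Far.symm hB hP' (far_compact hB hP' he hd hcB fun Q hQ => ?_)
  refine Far.symm hP' ?_ (h P hP Q hQ)
  rintro P' rfl; exact hB _ hQ

theorem mem_of_sq_le {P : Set K} (hP : IsOrderingCone P) (W : ValuationSubring K)
    (hW : ConvexWrtOrdering P (W : Set K)) {y : K} (hy : coneLT P (y ^ 2) 1) : y ∈ W := by
  obtain ⟨L, _, _, _, f, hf, hlt⟩ := cone_model' hP
  rw [hlt, map_one, map_pow, sq_lt_one_iff_abs_lt_one, abs_lt] at hy
  rcases le_total 0 (f y) with h | h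
  · refine hW y 1 ((hf _).2 h) ((hf _).2 ?_) W.one_mem
    rw [map_sub, map_one]; linarith
  · have := hW (-y) 1 ((hf _).2 ?_) ((hf _).2 ?_) W.one_mem
    · simpa using W.neg_mem _ this
    · rw [map_neg]; linarith
    · rw [map_sub, map_one, map_neg]; linarith

/-- **Theorem 1.7**: approximation with respect to pairwise disjoint Harrison-compact sets
of orderings under the compatibility condition on commonly convex valuation rings. -/
theorem approx_orderings {K : Type*} [Field K] (n : ℕ) (S : Fin n → Set (Set K))
    (hord : ∀ i, ∀ P ∈ S i, IsOrderingCone P)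
    (hdisj : ∀ i j, i ≠ j → ∀ P, P ∈ S i → P ∉ S j)
    (x z : Fin n → K) (hz : ∀ i, z i ≠ 0)
    (hT : ∀ i, @IsCompact (Set K) (harrisonTop K) (S i))
    (hI : ∀ i j, i ≠ j → ∀ P ∈ S i, ∀ Q ∈ S j, ∀ W : Set K, IsValuationLocality W →
      ConvexWrtOrdering P W → ConvexWrtOrdering Q W →
      ¬SameResidue W (P ∩ W) (Q ∩ W) ∧
        x i - x j ∈ scale (z i) W ∧ scale (z i) W = scale (z j) W) :
    ∃ a : K, ∀ i, ∀ P ∈ S i, coneLT P ((a - x i) ^ 2) (z i ^ 2) := by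
  suffices key : ∀ s : Finset (Fin n), ∀ N : ℕ, 0 < N →
      ∃ a : K, ∀ i ∈ s, ∀ P ∈ S i, coneLT P ((N * (a - x i)) ^ 2) (z i ^ 2) by
    obtain ⟨a, ha⟩ := key Finset.univ 1 one_pos
    refine ⟨a, fun i P hP => ?_⟩
    simpa using ha i (Finset.mem_univ i) P hP
  intro s
  induction s using Finset.induction_on with
  | empty => exact fun N hN => ⟨0, by simp⟩
  | insert j s hj ih =>
    intro N hN
    obtain ⟨b, hb⟩ := ih (2 * N) (by omega)
    set w : K := x j - b with hw
    let d : Fin n → K := fun i => 1 + (2 * N * (w / z i)) ^ 2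
    let e : K := 1 + (N * (w / z j)) ^ 2
    have hd : ∀ i, Ge1 (d i) := fun i => ge1_sq _
    have he : Ge1 e := ge1_sq _
    have hfar : ∀ i ∈ s, Far (S i) (d i) (S j) e := by
      intro i hi
      have hij : i ≠ j := fun h => hj (h ▸ hi)
      refine far_sets (hord i) (hord j) (hd i) he (hT i) (hT j) fun P hP Q hQ => ?_
      refine far_pair (hord i P hP) (hord j Q hQ) (hd i) he fun W hWP hWQ => ?_
      obtain ⟨h1, h2, h3⟩ := hI i j hij P hP Q hQ W ⟨W, rfl⟩ hWP hWQ
      have hbW : (b - x i) / z i ∈ W := by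
        refine mem_of_sq_le (hord i P hP) W hWP ?_
        have hb' := hb i hi P hP
        obtain ⟨L, _, _, _, f, hf, hlt⟩ := cone_model' (hord i P hP)
        rw [hlt] at hb' ⊢
        simp only [map_pow, map_mul, map_div₀, map_one, map_natCast] at hb' ⊢
        have hzi : 0 < f (z i) ^ 2 := by
          have : f (z i) ≠ 0 := (map_ne_zero f).2 (hz i)
          positivity
        rw [div_pow, div_lt_one hzi]
        refine lt_of_le_of_lt ?_ hb'
        rw [mul_pow]
        have h1N : (1 : L) ≤ ((2 * N : ℕ) : L) := by
          have : 1 ≤ 2 * N := by omega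
          exact_mod_cast this
        have := one_le_pow₀ (n := 2) h1N
        exact le_mul_of_one_le_left (sq_nonneg _) this
      have hwi : w / z i ∈ W := by
        obtain ⟨r, hr, hr'⟩ := h2
        have : w / z i = -((b - x i) / z i) + -r := by
          have : r = (x i - x j) / z i := by
            rw [hr', mul_div_cancel_left₀ _ (hz i)]
          rw [this, hw]
          field_simp [hz i]
          ring
        rw [this]
        exact W.add_mem _ _ (W.neg_mem _ hbW) (W.neg_mem _ hr)
      have hwj : w / z j ∈ W := by
        have : w ∈ scale (z i) (W : Set K) := ⟨w / z i, hwi, by field_simp [hz i]⟩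
        rw [h3] at this
        obtain ⟨r, hr, hr'⟩ := this
        rw [hr', mul_div_cancel_left₀ _ (hz j)]
        exact hr
      have hNW : (N : K) ∈ W := natCast_mem W N
      have h2W : (2 : K) ∈ W := by exact_mod_cast natCast_mem W 2
      refine ⟨?_, ?_, h1⟩
      · exact W.add_mem _ _ W.one_mem
          (pow_mem (W.mul_mem _ _ (W.mul_mem _ _ h2W hNW) hwi) 2)
      · exact W.add_mem _ _ W.one_mem (pow_mem (W.mul_mem _ _ hNW hwj) 2)
    have hall : ∀ t ⊆ s, ∃ h : K, TP h ∧ (∀ i ∈ t, ∀ P ∈ S i, coneLT P (2 * d i) h) ∧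
        ∀ Q ∈ S j, coneLT Q (2 * h * e) 1 := by
      intro t
      induction t using Finset.induction_on with
      | empty =>
        intro _
        obtain ⟨h, h1, _, h2⟩ := far_empty (d := 0) (hord j) he
        exact ⟨h, h1, by simp, h2⟩
      | insert k t hk iht =>
        intro hts
        obtain ⟨h, hp, h1, h2⟩ := iht (fun a ha => hts (Finset.mem_insert_of_mem ha))
        obtain ⟨h', hp', h1', h2'⟩ := hfar k (hts (Finset.mem_insert_self _ _))
        refine ⟨h ^ 2 + h' ^ 2, hp.oplus hp', ?_, ?_⟩
        · intro i hi P hP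
          rcases Finset.mem_insert.1 hi with rfl | hi
          · rw [add_comm]
            exact oplus_left (hord _ P hP) (hd _) (h1' P hP)
          · exact oplus_left (hord _ P hP) (hd _) (h1 i hi P hP)
        · intro Q hQ
          exact oplus_right (hord _ Q hQ) he hp hp' (h2 Q hQ) (h2' Q hQ)
    obtain ⟨h, hp, h1, h2⟩ := hall s (Finset.Subset.refl s)
    refine ⟨b + w * (1 + h)⁻¹, fun i hi P hP => ?_⟩
    have hpP := hp P (hord i P hP)
    rcases Finset.mem_insert.1 hi with rfl | hi
    · have h2P := h2 P hP
      obtain ⟨L, _, _, _, f, hf, hlt⟩ := cone_model' (hord i P hP)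
      have hzf : f (z i) ≠ 0 := (map_ne_zero f).2 (hz i)
      rw [hlt] at hpP h2P ⊢
      have hbw : b = x i - w := by rw [hw]; ring
      simp only [e, hbw, map_pow, map_mul, map_add, map_sub, map_inv₀, map_div₀, map_one, map_zero,
        map_natCast, map_ofNat] at hpP h2P ⊢
      generalize f h = t at *
      generalize f w = v at *
      generalize f (z i) = c at *
      have e1 : (N * (f (x i) - v + v * (1 + t)⁻¹ - f (x i))) ^ 2 =
          ((N * (v / c)) * (t / (1 + t))) ^ 2 * c ^ 2 := by
        have : 1 + t ≠ 0 := by positivity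
        field_simp
        ring
      rw [e1]
      generalize (N * (v / c) : L) = q at *
      have hc : 0 < c ^ 2 := by positivity
      suffices hs : (q * (t / (1 + t))) ^ 2 < 1 by
        calc _ < 1 * c ^ 2 := mul_lt_mul_of_pos_right hs hc
          _ = c ^ 2 := one_mul _
      rw [sq_lt_one_iff_abs_lt_one, abs_mul, abs_of_pos (by positivity : 0 < t / (1 + t)),
        ← mul_div_assoc, div_lt_one (by positivity)]
      have h3 : |q| ≤ 1 + q ^ 2 := by
        rw [← sq_abs]; nlinarith [sq_nonneg (|q| - 1)]
      have h4 : t * |q| ≤ t * (1 + q ^ 2) := mul_le_mul_of_nonneg_left h3 hpP.le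
      linarith
    · have h1P := h1 i hi P hP
      have hbP := hb i hi P hP
      obtain ⟨L, _, _, _, f, hf, hlt⟩ := cone_model' (hord i P hP)
      have hzf : f (z i) ≠ 0 := (map_ne_zero f).2 (hz i)
      rw [hlt] at hpP h1P hbP ⊢
      simp only [d, map_pow, map_mul, map_add, map_sub, map_inv₀, map_div₀, map_one, map_zero,
        map_natCast, map_ofNat] at hpP h1P hbP ⊢
      push_cast at hbP
      generalize f h = t at *
      generalize f w = v at *
      generalize f (z i) = c at *
      generalize f b = b' at *
      generalize f (x i) = x' at *
      have hc : 0 < |c| := by positivity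
      rw [sq_lt_sq] at hbP ⊢
      have e1 : (2 * N * (b' + v * (1 + t)⁻¹ - x') : L) =
          2 * N * (b' - x') + c * ((2 * N * (v / c)) * (1 + t)⁻¹) := by
        field_simp
        ring
      generalize (2 * N * (v / c) : L) = q at *
      have h3 : |q| ≤ 1 + q ^ 2 := by
        rw [← sq_abs]; nlinarith [sq_nonneg (|q| - 1)]
      have h4 : |c * (q * (1 + t)⁻¹)| < |c| := by
        rw [abs_mul, abs_mul, abs_inv, abs_of_pos (by linarith : 0 < 1 + t), ← div_eq_mul_inv]
        have : |q| / (1 + t) < 1 := by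
          rw [div_lt_one (by linarith)]
          nlinarith [sq_nonneg q]
        calc _ < |c| * 1 := mul_lt_mul_of_pos_left this hc
          _ = |c| := mul_one _
      have h5 : |2 * N * (b' + v * (1 + t)⁻¹ - x')| < |c| + |c| := by
        rw [e1]
        exact lt_of_le_of_lt (abs_add_le _ _) (add_lt_add hbP h4)
      rw [mul_assoc, abs_mul, abs_of_pos (by norm_num : (0 : L) < 2)] at h5
      linarith

end PaperApprox
end

section
/- Residue approximation: Let K be a field, t ∈ K^×, let S_1, …, S_n be sets of valuation rings of K, and let x_1, …, x_n ∈ K be such that x_i ∈ O_v for every v ∈ S_i and every i. Assume: (U) Assumption (U) holds for S = S_1 ∪ ⋯ ∪ S_n and t; (T) each S_i is compact in the topology T_{Zar*}; (I) the sets S_1, …, S_n are pairwise t-independent and pairwise incomparable. Then there exists x ∈ K such that for every i and every v ∈ S_i we have x ∈ O_v and x − x_i ∈ m_v (that is, x and x_i have the same residue in the residue field of v). -/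
namespace PaperApprox

variable {K : Type*} [Field K]

lemma mem_mball_iff (A : ValuationSubring K) (y : K) :
    y ∈ mball (A : Set K) ↔ A.valuation y < 1 := by
  unfold mball
  simp only [Set.mem_diff, Set.mem_inter_iff, Set.mem_setOf_eq, SetLike.mem_coe,
    ← A.valuation_le_one_iff, map_inv₀]
  rcases eq_or_ne y 0 with rfl | hy
  · simp
  · have h0 : 0 < A.valuation y := by simpa [zero_lt_iff] using hy
    constructor
    · rintro ⟨h1, h2⟩
      refine lt_of_le_of_ne h1 fun h => h2 ⟨h1, hy, ?_⟩
      simp [h]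
    · intro h
      refine ⟨h.le, fun h' => ?_⟩
      have := (inv_le_one₀ h0).1 h'.2.2
      exact absurd h (not_lt.2 this)

lemma pointwise_sep (A B : ValuationSubring K) (h1 : ¬ A ≤ B) (h2 : ¬ B ≤ A) (s : K)
    (hs0 : s ≠ 0) (hs' : s⁻¹ ∈ A ⊔ B) :
    ∃ c : K, A.valuation c < A.valuation s ∧ 1 < B.valuation (s * c) := by
  by_contra hcon
  push Not at hcon
  let Q : Subring K :=
    { carrier := {r | ∀ y, (∀ a ∈ A, y * a ∈ B) → ∀ a ∈ A, r * y * a ∈ B}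
      mul_mem' := by
        intro r r' hr hr' y hy a ha
        have := hr (r' * y) (hr' y hy) a ha
        rwa [← mul_assoc] at this
      one_mem' := by
        intro y hy a ha
        simpa using hy a ha
      add_mem' := by
        intro r r' hr hr' y hy a ha
        have := B.add_mem _ _ (hr y hy a ha) (hr' y hy a ha)
        simpa [add_mul] using this
      zero_mem' := by
        intro y hy a ha
        simp
      neg_mem' := by
        intro r hr y hy a ha
        have := B.neg_mem _ (hr y hy a ha)
        simpa using this }
  have hAQ : A.toSubring ≤ Q := by
    intro r hr y hy a ha
    have := hy (r * a) (A.mul_mem _ _ hr ha)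
    rwa [show r * y * a = y * (r * a) by ring]
  have hBQ : ∀ r ∈ B, r ∈ Q := by
    intro r hr y hy a ha
    rw [mul_assoc]
    exact B.mul_mem _ _ hr (hy a ha)
  have hW : A ⊔ B ≤ A.ofLE Q hAQ := sup_le (fun r hr => hAQ hr) (fun r hr => hBQ r hr)
  have hsQ : s⁻¹ ∈ Q := hW hs'
  have hm : ∀ m, A.valuation m < 1 → ∀ a ∈ A, m * a ∈ B := by
    intro m hm
    have h0 : ∀ a ∈ A, (s * s * m) * a ∈ B := by
      intro a ha
      rw [← B.valuation_le_one_iff]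
      have := hcon (s * m * a) ?_
      · rwa [show s * s * m * a = s * (s * m * a) by ring]
      · have hs1 : 0 < A.valuation s := by simpa [zero_lt_iff] using hs0
        have ha' := (A.valuation_le_one_iff a).2 ha
        have hma : A.valuation m * A.valuation a < 1 :=
          lt_of_le_of_lt (mul_le_of_le_one_right' ha') hm
        rw [map_mul, map_mul, mul_assoc]
        calc A.valuation s * (A.valuation m * A.valuation a) < A.valuation s * 1 :=
              mul_lt_mul_of_pos_left hma hs1
          _ = _ := mul_one _
    have h3 := hsQ _ (hsQ _ h0)
    have e : s⁻¹ * (s⁻¹ * (s * s * m)) = m := by field_simp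
    rwa [e] at h3
  obtain ⟨b, hbB, hbA⟩ := Set.not_subset.1 h2
  have hbA' : b ∉ A := hbA
  have hb0 : b ≠ 0 := by
    rintro rfl
    exact hbA' A.zero_mem
  have hbi : A.valuation b⁻¹ < 1 := by
    rw [← A.valuation_le_one_iff, not_le] at hbA'
    rw [map_inv₀]
    exact inv_lt_one_of_one_lt₀ hbA'
  refine h1 fun a ha => ?_
  have := hBQ b hbB _ (hm _ hbi) a ha
  rwa [mul_inv_cancel₀ hb0, one_mul] at this

/-- The only consequence of (U) which is used. -/
def Bd (f : Polynomial K) (t : K) (A : ValuationSubring K) : Prop :=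
  A.valuation t ≤ 1 ∧ ∀ x : K,
    A.valuation t * (max 1 (A.valuation x)) ^ f.natDegree ≤ A.valuation (f.eval x) ∧
      A.valuation (f.eval x) ≤ (max 1 (A.valuation x)) ^ f.natDegree

lemma le_of_not_scale (A : ValuationSubring K) (t : K) (ht : t ≠ 0) (y : K)
    (h : y ∉ scale t (mball (A : Set K))) : A.valuation t ≤ A.valuation y := by
  by_contra hlt
  push Not at hlt
  refine h ⟨y / t, ?_, by field_simp⟩
  have h0 : 0 < A.valuation t := by simpa [zero_lt_iff] using ht
  rw [mem_mball_iff, map_div₀, div_lt_one₀ h0]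
  exact hlt

lemma bd_of_cond (f : Polynomial K) (t : K) (ht : t ≠ 0) (A : ValuationSubring K)
    (h1 : CondI f (A : Set K)) (h2 : CondII t f (A : Set K)) (h3 : CondIII t f (A : Set K))
    (h4 : CondIV t (A : Set K)) : Bd f t A := by
  refine ⟨?_, fun x => ?_⟩
  · obtain ⟨s, hs, h⟩ := h4 1 A.one_mem 0 A.zero_mem
    have : t = s := by
      field_simp at h
      simpa using h
    rw [this, A.valuation_le_one_iff]
    exact hs
  · by_cases hx : x ∈ A
    · have hx' := (A.valuation_le_one_iff x).2 hx
      rw [max_eq_left hx', one_pow, mul_one]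
      exact ⟨le_of_not_scale A t ht _ (h2 x hx), (A.valuation_le_one_iff _).2 (h1 x hx)⟩
    · obtain ⟨⟨s, ⟨hs, hst⟩, h⟩, -⟩ := h3 x hx
      rw [← A.valuation_le_one_iff, not_le] at hx
      have ha := le_of_not_scale A t ht _ hst
      have hb := (A.valuation_le_one_iff s).2 hs
      rw [max_eq_right hx.le, h, map_mul, map_pow, mul_comm]
      exact ⟨mul_le_mul_right ha _, mul_le_of_le_one_right' hb⟩

lemma phi_bd (f : Polynomial K) (t : K) (A : ValuationSubring K) (h : Bd f t A)
    (a b : K) (hb : b ≠ 0) :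
    A.valuation t * (max (A.valuation b) (A.valuation a)) ^ f.natDegree ≤
        A.valuation (b ^ f.natDegree * f.eval (a / b)) ∧
      A.valuation (b ^ f.natDegree * f.eval (a / b)) ≤
        (max (A.valuation b) (A.valuation a)) ^ f.natDegree := by
  obtain ⟨h1, h2⟩ := h.2 (a / b)
  have hb0 : A.valuation b ≠ 0 := by simpa using hb
  have e : max (A.valuation b) (A.valuation a) =
      A.valuation b * max 1 (A.valuation (a / b)) := by
    rw [mul_max, mul_one, map_div₀, mul_div_cancel₀ _ hb0]
  rw [e, map_mul, map_pow, mul_pow]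
  refine ⟨?_, mul_le_mul_right h2 _⟩
  rw [mul_left_comm]
  exact mul_le_mul_right h1 _

lemma min_lemma (f : Polynomial K) (hd : 2 ≤ f.natDegree) (t : K) (ht : t ≠ 0)
    (SS : Set (ValuationSubring K)) (hSS : ∀ A ∈ SS, Bd f t A) (hne : SS.Nonempty)
    (c₀ : K) (hc₀ : c₀ ≠ 0) (L : List K) :
    ∃ (N M : ℕ) (c : K), c ≠ 0 ∧ M + 1 ≤ N ∧ ∀ A ∈ SS,
      (∀ y ∈ c₀ :: L, A.valuation t ^ M * A.valuation y ^ N ≤ A.valuation c) ∧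
      ∀ B : A.ValueGroup, (∀ y ∈ c₀ :: L, A.valuation y < B) → A.valuation c < B ^ N := by
  induction L with
  | nil =>
    refine ⟨1, 0, c₀, hc₀, le_rfl, fun A _ => ⟨?_, ?_⟩⟩
    · simp
    · simp
  | cons a L ih =>
    obtain ⟨N, M, c, hc, hMN, h⟩ := ih
    have key := fun A hA => phi_bd f t A (hSS A hA) (a ^ N) c hc
    refine ⟨N * f.natDegree, M * f.natDegree + 1,
      c ^ f.natDegree * f.eval (a ^ N / c), ?_, by nlinarith, fun A hA => ⟨?_, ?_⟩⟩
    · obtain ⟨A, hA⟩ := hne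
      have h0 : 0 < A.valuation t := by simpa [zero_lt_iff] using ht
      have h1 : 0 < A.valuation c := by simpa [zero_lt_iff] using hc
      have h2 := (key A hA).1
      have : 0 < A.valuation (c ^ f.natDegree * f.eval (a ^ N / c)) := by
        refine lt_of_lt_of_le (mul_pos h0 (pow_pos (lt_max_of_lt_left h1) _)) h2
      intro h3
      rw [h3] at this
      simp at this
    · have ht1 := (hSS A hA).1
      have hdesc : ∀ y : K, A.valuation t ^ M * A.valuation y ^ N ≤
          max (A.valuation c) (A.valuation (a ^ N)) →
          A.valuation t ^ (M * f.natDegree + 1) * A.valuation y ^ (N * f.natDegree) ≤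
            A.valuation (c ^ f.natDegree * f.eval (a ^ N / c)) := by
        intro y hy
        refine le_trans ?_ (key A hA).1
        have := pow_le_pow_left₀ zero_le hy f.natDegree
        calc _ = A.valuation t * (A.valuation t ^ M * A.valuation y ^ N) ^ f.natDegree := by
              rw [mul_pow, ← pow_mul, ← pow_mul, pow_succ, mul_comm (_ ^ _) (A.valuation t), mul_assoc]
          _ ≤ _ := mul_le_mul_right this _
      intro y hy
      apply hdesc
      simp only [List.mem_cons] at hy
      have h' := (h A hA).1
      simp only [List.mem_cons] at h'
      rcases hy with hy | hy | hy
      · exact le_max_of_le_left (h' y (Or.inl hy))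
      · subst hy
        refine le_max_of_le_right ?_
        rw [map_pow]
        exact mul_le_of_le_one_left' (pow_le_one₀ zero_le ht1)
      · exact le_max_of_le_left (h' y (Or.inr hy))
    · intro B hB
      refine lt_of_le_of_lt (key A hA).2 ?_
      rw [pow_mul]
      refine pow_lt_pow_left₀ (max_lt ?_ ?_) zero_le (by omega)
      · apply (h A hA).2
        intro y hy
        apply hB
        simp only [List.mem_cons] at hy ⊢
        tauto
      · rw [map_pow]
        exact pow_lt_pow_left₀ (hB a (by simp)) zero_le (by omega)

lemma stage (f : Polynomial K) (hd : 2 ≤ f.natDegree) (t : K) (ht : t ≠ 0)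
    (SS : Set (ValuationSubring K)) (hSS : ∀ A ∈ SS, Bd f t A)
    (τ : K) (hτ0 : τ ≠ 0) (hτ : ∀ A ∈ SS, A.valuation τ ≤ A.valuation t)
    (T : Set (Set K)) (hT : @IsCompact (Set K) (zarStarTop K) T) (hTne : T.Nonempty)
    (hTS : ∀ w ∈ T, ∃ A ∈ SS, w = (A : Set K))
    (V : Set (ValuationSubring K)) (hV : V ⊆ SS) (k : ℕ)
    (h : ∀ B ∈ SS, (B : Set K) ∈ T → ∃ c : K,
      (∀ A ∈ V, A.valuation c < A.valuation (τ ^ (k + 1))) ∧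
        1 < B.valuation (τ ^ (k + 1) * c)) :
    ∃ c : K, c ≠ 0 ∧ (∀ A ∈ V, A.valuation c < A.valuation (τ ^ k)) ∧
      ∀ B ∈ SS, (B : Set K) ∈ T → 1 < B.valuation (τ ^ k * c) := by
  classical
  have hτ1 : ∀ A ∈ SS, A.valuation τ ≤ 1 := fun A hA => (hτ A hA).trans (hSS A hA).1
  let I := {c : K // c ≠ 0 ∧ ∀ A ∈ V, A.valuation c < A.valuation (τ ^ (k + 1))}
  let U : I → Set (Set K) := fun c => {O | (τ ^ (k + 1) * c.1)⁻¹ ∈ mball O}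
  have hUB : ∀ (B : ValuationSubring K) (c : I), (B : Set K) ∈ U c ↔
      1 < B.valuation (τ ^ (k + 1) * c.1) := by
    intro B c
    have h0 : 0 < B.valuation (τ ^ (k + 1) * c.1) := by
      rw [zero_lt_iff, Valuation.ne_zero_iff]
      exact mul_ne_zero (pow_ne_zero _ hτ0) c.2.1
    change _ ∈ mball _ ↔ _
    rw [mem_mball_iff, map_inv₀, inv_lt_one₀ h0]
  have hUo : ∀ c, @IsOpen _ (zarStarTop K) (U c) := fun c =>
    TopologicalSpace.isOpen_generateFrom_of_mem ⟨_, rfl⟩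
  have hcov : T ⊆ ⋃ c, U c := by
    intro w hw
    obtain ⟨B, hB, rfl⟩ := hTS w hw
    obtain ⟨c, hc1, hc2⟩ := h B hB hw
    have hc0 : c ≠ 0 := by
      rintro rfl
      simp at hc2
    exact Set.mem_iUnion.2 ⟨⟨c, hc0, hc1⟩, (hUB B _).2 hc2⟩
  obtain ⟨F, hF⟩ := @IsCompact.elim_finite_subcover _ (zarStarTop K) _ _ hT U hUo hcov
  obtain ⟨w₀, hw₀⟩ := hTne
  obtain ⟨B₀, hB₀, rfl⟩ := hTS _ hw₀
  obtain ⟨c₀, -⟩ := Set.mem_iUnion.1 (hcov hw₀)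
  obtain ⟨N, M, c, hc0, hMN, hc⟩ := min_lemma f hd t ht SS hSS ⟨B₀, hB₀⟩ c₀.1 c₀.2.1
    (F.toList.map Subtype.val)
  refine ⟨c, hc0, fun A hA => ?_, fun B hB hBT => ?_⟩
  · have h1 : A.valuation c < A.valuation (τ ^ (k + 1)) ^ N := by
      apply (hc A (hV hA)).2
      intro y hy
      simp only [List.mem_cons, List.mem_map] at hy
      rcases hy with rfl | ⟨z, -, rfl⟩
      · exact c₀.2.2 A hA
      · exact z.2.2 A hA
    refine lt_of_lt_of_le h1 ?_
    rw [map_pow, map_pow, ← pow_mul]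
    exact pow_le_pow_of_le_one zero_le (hτ1 A (hV hA)) (by nlinarith)
  · obtain ⟨z, hz⟩ := Set.mem_iUnion.1 (hF hBT)
    obtain ⟨hzF, hz⟩ := Set.mem_iUnion.1 hz
    rw [hUB] at hz
    have h1 := (hc B hB).1 z.1 (by
      simp only [List.mem_cons, List.mem_map]
      exact Or.inr ⟨z, by simpa using hzF, rfl⟩)
    have h2 : 1 < B.valuation (τ ^ (k + 1) * z.1) ^ N := one_lt_pow₀ hz (by omega)
    refine lt_of_lt_of_le h2 ?_
    rw [map_mul, map_mul, map_pow, map_pow, mul_pow, ← pow_mul]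
    have hτt := hτ B hB
    have hτ1' := hτ1 B hB
    calc B.valuation τ ^ ((k + 1) * N) * B.valuation z.1 ^ N
        ≤ B.valuation τ ^ (k + M) * B.valuation z.1 ^ N := by
          refine mul_le_mul_left (pow_le_pow_of_le_one zero_le hτ1' (by nlinarith)) _
      _ = B.valuation τ ^ k * (B.valuation τ ^ M * B.valuation z.1 ^ N) := by
          rw [pow_add, mul_assoc]
      _ ≤ B.valuation τ ^ k * (B.valuation t ^ M * B.valuation z.1 ^ N) :=
          mul_le_mul_right (mul_le_mul_left (pow_le_pow_left₀ zero_le hτt _) _) _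
      _ ≤ _ := mul_le_mul_right h1 _

lemma sep_exists (f : Polynomial K) (hd : 2 ≤ f.natDegree) (t : K) (ht : t ≠ 0)
    (S T : Set (Set K)) (SS : Set (ValuationSubring K)) (hSS : ∀ A ∈ SS, Bd f t A)
    (hS' : ∀ w ∈ S, ∃ A ∈ SS, w = (A : Set K))
    (hT' : ∀ w ∈ T, ∃ A ∈ SS, w = (A : Set K))
    (hS : @IsCompact (Set K) (zarStarTop K) S) (hT : @IsCompact (Set K) (zarStarTop K) T)
    (hti : ∀ v ∈ S, ∀ w ∈ T, TIndepVal t v w) (hinc : SetIncomp S T)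
    (x : K) (hx : ∀ v ∈ S, x ∈ v) :
    ∃ e : K, (∀ A ∈ SS, (A : Set K) ∈ S → A.valuation (e - x) < 1) ∧
      ∀ A ∈ SS, (A : Set K) ∈ T → A.valuation e < 1 := by
  rcases S.eq_empty_or_nonempty with rfl | hSne
  · exact ⟨0, by simp, by simp⟩
  rcases T.eq_empty_or_nonempty with rfl | hTne
  · exact ⟨x, by simp, by simp⟩
  have htv : ∀ A : ValuationSubring K, 0 < A.valuation t := fun A => by
    simpa [zero_lt_iff] using ht
  have hft : ∀ A ∈ SS, A.valuation t ≤ A.valuation (f.eval x) := fun A hA =>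
    le_trans (le_mul_of_one_le_right' (one_le_pow₀ (le_max_left _ _))) ((hSS A hA).2 x).1
  have hf0 : f.eval x ≠ 0 := by
    obtain ⟨w, hw⟩ := hSne
    obtain ⟨A, hA, -⟩ := hS' w hw
    have := lt_of_lt_of_le (htv A) (hft A hA)
    intro h
    simp [h] at this
  have hfv : ∀ A : ValuationSubring K, 0 < A.valuation (f.eval x) := fun A => by
    simpa [zero_lt_iff] using hf0
  obtain ⟨τ, hτdef⟩ : ∃ τ, τ = t * (t / f.eval x) := ⟨_, rfl⟩
  have hτ0 : τ ≠ 0 := by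
    rw [hτdef]
    exact mul_ne_zero ht (div_ne_zero ht hf0)
  have hq : ∀ A ∈ SS, A.valuation (t / f.eval x) ≤ 1 := fun A hA => by
    rw [map_div₀]
    exact div_le_one_of_le₀ (hft A hA) zero_le
  have hτ : ∀ A ∈ SS, A.valuation τ ≤ A.valuation t := fun A hA => by
    rw [hτdef, map_mul]
    exact mul_le_of_le_one_right' (hq A hA)
  have hτx : ∀ A ∈ SS, A.valuation (τ * x) ≤ 1 := fun A hA => by
    have h1 : A.valuation t * A.valuation x ≤ A.valuation (f.eval x) := by
      refine le_trans (mul_le_mul_right ?_ _) ((hSS A hA).2 x).1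
      exact (le_max_right 1 _).trans (le_self_pow₀ (le_max_left _ _) (by omega))
    have h2 : A.valuation (τ * x) = A.valuation t * (A.valuation t * A.valuation x / A.valuation (f.eval x)) := by
      rw [hτdef, ← map_mul, ← map_div₀, ← map_mul]
      congr 1
      ring
    rw [h2]
    exact mul_le_one' (hSS A hA).1 (div_le_one_of_le₀ h1 zero_le)
  have hpt : ∀ A ∈ SS, (A : Set K) ∈ S → ∀ B ∈ SS, (B : Set K) ∈ T → ∃ c : K,
      A.valuation c < A.valuation (τ ^ 3) ∧ 1 < B.valuation (τ ^ 3 * c) := by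
    intro A hA hAS B hB hBT
    obtain ⟨i1, i2⟩ := hinc _ hAS _ hBT
    refine pointwise_sep A B (fun h => i1 h) (fun h => i2 h) _ (pow_ne_zero _ hτ0) ?_
    obtain ⟨-, htW⟩ := hti _ hAS _ hBT ((A ⊔ B : ValuationSubring K) : Set K) ⟨_, rfl⟩
      (fun y hy => (le_sup_left : A ≤ A ⊔ B) hy) (fun y hy => (le_sup_right : B ≤ A ⊔ B) hy)
      (by
        rintro W' ⟨C, rfl⟩ h1 h2
        have : A ⊔ B ≤ C := sup_le (fun y hy => h1 hy) (fun y hy => h2 hy)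
        exact fun y hy => this hy)
    have htW' : t⁻¹ ∈ A ⊔ B := htW
    have hfA : f.eval x ∈ A := by
      rw [← A.valuation_le_one_iff]
      have hxA := (A.valuation_le_one_iff x).2 (hx _ hAS)
      have := ((hSS A hA).2 x).2
      rwa [max_eq_left hxA, one_pow] at this
    have hfW : f.eval x ∈ A ⊔ B := (le_sup_left : A ≤ A ⊔ B) hfA
    have : τ⁻¹ = t⁻¹ * (t⁻¹ * f.eval x) := by
      rw [hτdef]
      field_simp
    rw [← inv_pow, this]
    exact pow_mem (mul_mem htW' (mul_mem htW' hfW)) 3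
  have st1 : ∀ A ∈ SS, (A : Set K) ∈ S → ∃ c : K, c ≠ 0 ∧
      A.valuation c < A.valuation (τ ^ 2) ∧
      ∀ B ∈ SS, (B : Set K) ∈ T → 1 < B.valuation (τ ^ 2 * c) := by
    intro A hA hAS
    have := stage f hd t ht SS hSS τ hτ0 hτ T hT hTne hT' {A} (by simpa using hA) 2
      (by simpa using hpt A hA hAS)
    simpa using this
  obtain ⟨c, hc0, hcT, hcS⟩ := stage f hd t ht SS hSS τ hτ0 hτ S hS hSne hS'
    {B | B ∈ SS ∧ (B : Set K) ∈ T} (fun B hB => hB.1) 1 (by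
      intro A hA hAS
      obtain ⟨c, hc0, h1, h2⟩ := st1 A hA hAS
      refine ⟨c⁻¹, ?_, ?_⟩
      · rintro B ⟨hB, hBT⟩
        have h3 := h2 B hB hBT
        have h4 : 0 < B.valuation c := by simpa [zero_lt_iff] using hc0
        rw [map_inv₀, inv_lt_iff_one_lt_mul₀ h4, ← map_mul, mul_comm]
        simpa [mul_comm] using h3
      · have h4 : 0 < A.valuation c := by simpa [zero_lt_iff] using hc0
        rw [map_mul, map_inv₀, ← div_eq_mul_inv, one_lt_div₀ h4]
        exact h1)
  simp only [pow_one] at hcT hcS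
  have hτ1 : ∀ A ∈ SS, A.valuation τ ≤ 1 := fun A hA => (hτ A hA).trans (hSS A hA).1
  refine ⟨c / (1 + c) * x, fun A hA hAS => ?_, fun B hB hBT => ?_⟩
  · have h1 : 1 < A.valuation c := by
      refine lt_of_lt_of_le (hcS A hA hAS) ?_
      rw [map_mul]
      exact mul_le_of_le_one_left' (hτ1 A hA)
    have h2 : A.valuation (1 + c) = A.valuation c :=
      Valuation.map_add_eq_of_lt_right _ (by rw [map_one]; exact h1)
    have h3 : 1 + c ≠ 0 := by
      intro h
      rw [h] at h2
      simp [← h2] at h1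
    have e : c / (1 + c) * x - x = - (x / (1 + c)) := by
      field_simp
      ring
    have hxA := (A.valuation_le_one_iff x).2 (hx _ hAS)
    rw [e, Valuation.map_neg, map_div₀, h2, div_lt_one₀ (zero_lt_one.trans h1)]
    exact lt_of_le_of_lt hxA h1
  · have h0 := hcT B ⟨hB, hBT⟩
    have h1 : B.valuation c < 1 := lt_of_lt_of_le h0 (hτ1 B hB)
    have h2 : B.valuation (1 + c) = 1 := by
      rw [Valuation.map_add_eq_of_lt_left _ (by rw [map_one]; exact h1), map_one]
    rw [map_mul, map_div₀, h2, div_one]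
    rcases eq_or_ne x 0 with rfl | hx0
    · simp
    have hxp : 0 < B.valuation x := by simpa [zero_lt_iff] using hx0
    refine lt_of_lt_of_le (mul_lt_mul_of_pos_right h0 hxp) ?_
    rw [← map_mul]
    exact hτx B hB

/-- **Corollary 5.3** (residue approximation): there is `x` integral at all `v ∈ S i`
with the same residue as `x i` at each such `v`. -/
theorem residue_approximation {K : Type*} [Field K] (t : K) (ht : t ≠ 0)
    (n : ℕ) (S : Fin n → Set (Set K))
    (hval : ∀ i, ∀ v ∈ S i, IsValuationLocality v)
    (x : Fin n → K) (hx : ∀ i, ∀ v ∈ S i, x i ∈ v)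
    (hU : AssumptionU (⋃ i, S i) t)
    (hT : ∀ i, @IsCompact (Set K) (zarStarTop K) (S i))
    (hti : ∀ i j, i ≠ j → ∀ v ∈ S i, ∀ w ∈ S j, TIndepVal t v w)
    (hinc : ∀ i j, i ≠ j → SetIncomp (S i) (S j)) :
    ∃ a : K, ∀ i, ∀ v ∈ S i, a ∈ v ∧ a - x i ∈ mball v := by
  classical
  obtain ⟨f, hd, hf⟩ := hU
  let SS : Set (ValuationSubring K) := {A | (A : Set K) ∈ ⋃ i, S i}
  have hSS : ∀ A ∈ SS, Bd f t A := fun A hA =>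
    bd_of_cond f t ht A (hf _ hA).1 (hf _ hA).2.1 (hf _ hA).2.2.1 (hf _ hA).2.2.2
  have hS' : ∀ i, ∀ w ∈ S i, ∃ A ∈ SS, w = (A : Set K) := by
    intro i w hw
    obtain ⟨A, rfl⟩ := hval i w hw
    exact ⟨A, Set.mem_iUnion.2 ⟨i, hw⟩, rfl⟩
  have main : ∀ i, ∃ e : K, (∀ A ∈ SS, (A : Set K) ∈ S i → A.valuation (e - x i) < 1) ∧
      ∀ A ∈ SS, (A : Set K) ∈ (⋃ j ∈ Finset.univ.erase i, S j) → A.valuation e < 1 := by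
    intro i
    refine sep_exists f hd t ht (S i) (⋃ j ∈ Finset.univ.erase i, S j) SS hSS (hS' i) ?_ (hT i)
      ?_ ?_ ?_ (x i) (hx i)
    · intro w hw
      simp only [Set.mem_iUnion] at hw
      obtain ⟨j, -, hw⟩ := hw
      exact hS' j w hw
    · exact @Finset.isCompact_biUnion _ _ (zarStarTop K) _ _ (fun j _ => hT j)
    · intro v hv w hw
      simp only [Set.mem_iUnion] at hw
      obtain ⟨j, hj, hw⟩ := hw
      exact hti i j (Finset.ne_of_mem_erase hj).symm v hv w hw
    · intro v hv w hw
      simp only [Set.mem_iUnion] at hw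
      obtain ⟨j, hj, hw⟩ := hw
      exact hinc i j (Finset.ne_of_mem_erase hj).symm v hv w hw
  choose e he1 he2 using main
  refine ⟨∑ i, e i, fun i v hv => ?_⟩
  obtain ⟨A, hA, rfl⟩ := hS' i v hv
  have hlt : A.valuation (∑ j, e j - x i) < 1 := by
    rw [← Finset.add_sum_erase _ _ (Finset.mem_univ i), add_sub_right_comm]
    refine Valuation.map_add_lt _ (he1 i A hA hv) (Valuation.map_sum_lt _ one_ne_zero ?_)
    intro j hj
    refine he2 j A hA ?_
    simp only [Set.mem_iUnion]
    exact ⟨i, Finset.mem_erase.2 ⟨(Finset.ne_of_mem_erase hj).symm, Finset.mem_univ _⟩, hv⟩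
  refine ⟨?_, (mem_mball_iff A _).2 hlt⟩
  have h1 : ∑ j, e j - x i ∈ A := (A.valuation_le_one_iff _).1 hlt.le
  have h2 := A.add_mem _ _ h1 (hx i _ hv)
  rw [sub_add_cancel] at h2
  exact h2

end PaperApprox
end
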